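/- (Global-in-time quintic multilinear estimate for the first nonlocal nonlinearity, established in the proof of Lemma 2.5.) For every s > 0 there exists ε₀ ∈ (0, 1/2) such that for every ε ∈ (0, ε₀) there is a constant C = C(s, ε) > 0 with the following property: for all w₁, w₂ ∈ L¹(Λ; ℝ) and all smooth functions v₁, …, v₅ : Λ × ℝ → ℂ with compact support in the time variable, the function 𝒩₁(v₁,…,v₅)(x,t) := ∫_Λ ∫_Λ w₁(x−y) w₂(x−z) v₁(y,t) conj(v₂(y,t)) v₃(z,t) conj(v₄(z,t)) v₅(x,t) dy dz satisfies ‖𝒩₁(v₁,…,v₅)‖_{X^{s,−1/2+ε}} ≤ C ‖w₁‖_{L¹} ‖w₂‖_{L¹} ∏_{j=1}^{5} ‖v_j‖_{X^{s,1/2−ε}}. -/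

import Mathlib

open MeasureTheory Complex
open scoped ENNReal

noncomputable section

/-- The spacetime Fourier transform `ṽ(k,η) = ∫_ℝ ∫_Λ v(x,t) e^{−2πikx − 2πiηt} dx dt` of a
function `v : Λ × ℝ → ℂ` on the torus `Λ = ℝ/ℤ` times the real line. -/
def spacetimeFT (v : AddCircle (1:ℝ) → ℝ → ℂ) (k : ℤ) (η : ℝ) : ℂ :=
  ∫ t : ℝ, ∫ x : AddCircle (1:ℝ),
    v x t * fourier (-k) x * Complex.exp (-(2 * Real.pi * η * t) * Complex.I)

/-- The `X^{s,b}` norm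
`‖v‖_{X^{s,b}} = ( Σ_{k∈ℤ} ∫_ℝ (1+|2πk|)^{2s} (1+|η+2πk²|)^{2b} |ṽ(k,η)|² dη )^{1/2}`,
valued in `ℝ≥0∞`. -/
def Xnorm (s b : ℝ) (v : AddCircle (1:ℝ) → ℝ → ℂ) : ℝ≥0∞ :=
  (∑' k : ℤ, ∫⁻ η : ℝ, ENNReal.ofReal
      ((1 + |2 * Real.pi * (k:ℝ)|) ^ (2*s) * (1 + |η + 2 * Real.pi * (k:ℝ)^2|) ^ (2*b) *
        ‖spacetimeFT v k η‖ ^ 2)) ^ ((1:ℝ)/2)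

/-- The first nonlocal quintic nonlinearity
`𝒩₁(v₁,…,v₅)(x,t) = ∫∫ w₁(x−y) w₂(x−z) v₁(y,t) conj(v₂(y,t)) v₃(z,t) conj(v₄(z,t)) v₅(x,t) dy dz`. -/
def N1 (w₁ w₂ : AddCircle (1:ℝ) → ℝ) (v : Fin 5 → AddCircle (1:ℝ) → ℝ → ℂ)
    (x : AddCircle (1:ℝ)) (t : ℝ) : ℂ :=
  ∫ y : AddCircle (1:ℝ), ∫ z : AddCircle (1:ℝ),
    (w₁ (x - y) : ℂ) * (w₂ (x - z) : ℂ) *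
      v 0 y t * (starRingEnd ℂ) (v 1 y t) * v 2 z t * (starRingEnd ℂ) (v 3 z t) * v 4 x t


theorem divisor_bound (δ : ℝ) (hδ : 0 < δ) : ∃ C : ℝ, 1 ≤ C ∧ ∀ n : ℕ, n ≠ 0 →
    (n.divisors.card : ℝ) ≤ C * (n:ℝ) ^ δ := by
  set K : ℝ := max 1 (1 / (δ * Real.log 2)) with hK
  have hl2 : 0 < δ * Real.log 2 := mul_pos hδ (Real.log_pos (by norm_num))
  have hK1 : 1 ≤ K := le_max_left _ _
  obtain ⟨P, hP⟩ := exists_nat_ge ((2:ℝ) ^ (1/δ))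
  refine ⟨K ^ P, one_le_pow₀ hK1, fun n hn => ?_⟩
  have hfac : ∀ p ∈ n.primeFactors, ((n.factorization p : ℝ) + 1) ≤
      (if p < P then K else 1) * ((p:ℝ) ^ (n.factorization p)) ^ δ := by
    intro p hp
    have hp2 : 2 ≤ p := (Nat.prime_of_mem_primeFactors hp).two_le
    have hp2' : (2:ℝ) ≤ p := by exact_mod_cast hp2
    set v := n.factorization p
    have hcomm : ((p:ℝ) ^ v) ^ δ = ((p:ℝ) ^ δ) ^ v := by
      rw [← Real.rpow_natCast, ← Real.rpow_natCast, ← Real.rpow_mul (by positivity),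
        ← Real.rpow_mul (by positivity), mul_comm]
    split_ifs with h
    · have h1 : (1:ℝ) + v * (δ * Real.log 2) ≤ ((p:ℝ) ^ v) ^ δ := by
        have : ((2:ℝ) ^ v) ^ δ ≤ ((p:ℝ) ^ v) ^ δ := by gcongr
        refine le_trans ?_ this
        have e : ((2:ℝ) ^ v) ^ δ = Real.exp (v * (δ * Real.log 2)) := by
          rw [← Real.rpow_natCast, ← Real.rpow_mul (by positivity), Real.rpow_def_of_pos (by norm_num)]
          congr 1; ring
        rw [e]
        linarith [Real.add_one_le_exp (v * (δ * Real.log 2))]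
      have h2 : (1:ℝ) ≤ K * (δ * Real.log 2) := by
        calc (1:ℝ) = 1 / (δ * Real.log 2) * (δ * Real.log 2) := by field_simp
          _ ≤ _ := by gcongr; exact le_max_right _ _
      calc (v:ℝ) + 1 ≤ K * (1 + v * (δ * Real.log 2)) := by
            have : (v:ℝ) * 1 ≤ v * (K * (δ * Real.log 2)) := by gcongr
            nlinarith
        _ ≤ _ := by gcongr
    · rw [one_mul, hcomm]
      have h3 : (2:ℝ) ≤ (p:ℝ) ^ δ := by
        have : (2:ℝ) ^ (1/δ) ≤ p := hP.trans (by exact_mod_cast not_lt.mp h)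
        calc (2:ℝ) = ((2:ℝ) ^ (1/δ)) ^ δ := by
              rw [← Real.rpow_mul (by norm_num)]; field_simp; simp
          _ ≤ _ := by gcongr
      calc (v:ℝ) + 1 ≤ 2 ^ v := by exact_mod_cast Nat.lt_two_pow_self
        _ ≤ _ := by gcongr
  rw [Nat.card_divisors hn]
  push_cast
  calc ∏ p ∈ n.primeFactors, ((n.factorization p : ℝ) + 1)
      ≤ ∏ p ∈ n.primeFactors, ((if p < P then K else 1) * ((p:ℝ) ^ (n.factorization p)) ^ δ) :=
        Finset.prod_le_prod (fun _ _ => by positivity) hfac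
    _ = (∏ p ∈ n.primeFactors, (if p < P then K else 1)) *
        (∏ p ∈ n.primeFactors, (p:ℝ) ^ (n.factorization p)) ^ δ := by
        rw [Finset.prod_mul_distrib, Real.finsetProd_rpow _ _ (fun _ _ => by positivity)]
    _ ≤ K ^ P * (n:ℝ) ^ δ := by
        have e : (∏ p ∈ n.primeFactors, (p:ℝ) ^ (n.factorization p)) = n := by
          conv_rhs => rw [← Nat.prod_factorization_pow_eq_self hn]
          simp [Finsupp.prod]
        rw [e]
        gcongr
        rw [← Finset.prod_filter, Finset.prod_const]
        refine pow_le_pow_right₀ hK1 ?_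
        calc _ ≤ (Finset.range P).card := Finset.card_le_card (by
              intro p; simp)
          _ = P := by simp


theorem pair_sum (δ C : ℝ) (hC1 : 1 ≤ C) (hC : ∀ n : ℕ, n ≠ 0 → (n.divisors.card : ℝ) ≤ C * (n:ℝ) ^ δ)
    (B : ℝ) (hB : 0 ≤ B) (u : ℤ → ℤ → ℝ) (N : ℤ) (hN : N ≠ 0) (good : ℤ → ℤ → Prop)
    (hle : ∀ a c, u a c ≤ 1)
    (hgood : ∀ a c, a * c = N → ¬ good a c → u a c ≤ B * (|N| : ℝ) ^ (-δ))
    (L : Finset (ℤ × ℤ)) (hL : ∀ a c, a * c = N → good a c → (a, c) ∈ L) (hcard : L.card ≤ 2) :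
    ∑' a : ℤ, ∑' c : ℤ, (if a * c = N then ENNReal.ofReal (u a c) else 0) ≤
      ENNReal.ofReal (2 + 2 * B * C) := by
  classical
  rw [← ENNReal.tsum_prod (f := fun a c => if a * c = N then ENNReal.ofReal (u a c) else 0)]
  set S : Finset (ℤ × ℤ) := (N.natAbs.divisors ×ˢ ({1, -1} : Finset ℤ)).image
    (fun x => (x.2 * (x.1 : ℤ), N / (x.2 * (x.1:ℤ)))) with hS
  have hScard : (S.card : ℝ) ≤ 2 * (C * (|N|:ℝ) ^ δ) := by
    have h1 : S.card ≤ N.natAbs.divisors.card * 2 := by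
      refine Finset.card_image_le.trans ?_
      rw [Finset.card_product]; gcongr; exact Finset.card_le_two
    have h2 := hC N.natAbs (by omega)
    have h3 : ((N.natAbs : ℕ) : ℝ) = |(N:ℝ)| := by rw [Nat.cast_natAbs]; simp
    rw [h3] at h2
    calc (S.card : ℝ) ≤ N.natAbs.divisors.card * 2 := by exact_mod_cast h1
      _ ≤ _ := by linarith
  have hmem : ∀ a c : ℤ, a * c = N → (a, c) ∈ S := by
    intro a c h
    have ha : a ≠ 0 := by rintro rfl; simp at h; exact hN h.symm
    rw [hS, Finset.mem_image]
    refine ⟨(a.natAbs, a.sign), ?_, ?_⟩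
    · simp only [Finset.mem_product, Nat.mem_divisors, Finset.mem_insert, Finset.mem_singleton]
      refine ⟨⟨?_, by omega⟩, ?_⟩
      · rw [Int.natAbs_dvd_natAbs]; exact ⟨c, h.symm⟩
      · rcases lt_or_gt_of_ne ha with h' | h'
        · right; exact Int.sign_eq_neg_one_of_neg h'
        · left; exact Int.sign_eq_one_of_pos h'
    · simp only [Int.sign_mul_natAbs]
      rw [← h, Int.mul_ediv_cancel_left _ ha]
  rw [tsum_eq_sum (s := S)]
  · have hNpos : (0:ℝ) < |(N:ℝ)| := by positivity
    calc ∑ x ∈ S, (if x.1 * x.2 = N then ENNReal.ofReal (u x.1 x.2) else 0)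
        ≤ ∑ x ∈ S, ((if x ∈ L then 1 else 0) + ENNReal.ofReal (B * (|N| : ℝ) ^ (-δ))) := by
          refine Finset.sum_le_sum fun x _ => ?_
          split_ifs with h1 h2
          · refine le_add_right ?_
            exact ENNReal.ofReal_le_one.mpr (hle _ _)
          · refine le_add_left (ENNReal.ofReal_le_ofReal (hgood _ _ h1 fun hg => h2 (hL _ _ h1 hg)))
          · exact zero_le
          · exact zero_le
      _ ≤ 2 + ENNReal.ofReal (2 * B * C) := by
          rw [Finset.sum_add_distrib]
          gcongr
          · rw [← Finset.sum_filter, Finset.sum_const, nsmul_eq_mul, mul_one]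
            have : (Finset.filter (· ∈ L) S).card ≤ 2 :=
              (Finset.card_le_card (fun x hx => (Finset.mem_filter.mp hx).2)).trans hcard
            exact_mod_cast this
          · rw [Finset.sum_const, nsmul_eq_mul, ← ENNReal.ofReal_natCast, ← ENNReal.ofReal_mul (by positivity)]
            apply ENNReal.ofReal_le_ofReal
            calc (S.card:ℝ) * (B * (|N| : ℝ) ^ (-δ)) ≤ 2 * (C * (|N|:ℝ) ^ δ) * (B * (|N| : ℝ) ^ (-δ)) := by
                  gcongr
              _ = 2 * B * C * ((|N|:ℝ) ^ δ * (|N| : ℝ) ^ (-δ)) := by ring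
              _ = 2 * B * C := by
                  rw [← Real.rpow_add hNpos]; simp
      _ = _ := by
          rw [ENNReal.ofReal_add (by norm_num) (by positivity)]; simp
  · rintro ⟨a, c⟩ h
    simp only [ite_eq_right_iff]
    intro h'
    exact absurd (hmem a c h') h

theorem u_bound (s : ℝ) (hs : 0 < s) (m m' N : ℤ) (h : |(N:ℝ)| ≤ 16 * (1 + max |(m:ℝ)| |(m':ℝ)|) ^ 4)
    (hN : N ≠ 0) :
    (1 + |(m:ℝ)|) ^ (-s) * (1 + |(m':ℝ)|) ^ (-s) ≤ 16 ^ (s/4) * |(N:ℝ)| ^ (-(s/4)) := by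
  set X := 1 + max |(m:ℝ)| |(m':ℝ)| with hX
  have hX0 : 0 < X := by positivity
  have hNpos : (0:ℝ) < |(N:ℝ)| := by positivity
  have h1 : (1 + |(m:ℝ)|) ^ (-s) * (1 + |(m':ℝ)|) ^ (-s) ≤ X ^ (-s) := by
    have a1 : (1 + |(m:ℝ)|) ^ (-s) ≤ 1 := Real.rpow_le_one_of_one_le_of_nonpos (by simp) (by linarith)
    have a2 : (1 + |(m':ℝ)|) ^ (-s) ≤ 1 := Real.rpow_le_one_of_one_le_of_nonpos (by simp) (by linarith)
    have b1 : 0 ≤ (1 + |(m:ℝ)|) ^ (-s) := by positivity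
    have b2 : 0 ≤ (1 + |(m':ℝ)|) ^ (-s) := by positivity
    rcases max_choice |(m:ℝ)| |(m':ℝ)| with h' | h' <;> rw [hX, h'] <;> nlinarith
  refine h1.trans ?_
  have h2 : X ^ (-s) = 16 ^ (s/4) * (16 * X ^ 4) ^ (-(s/4)) := by
    rw [Real.mul_rpow (by norm_num) (by positivity), ← mul_assoc, ← Real.rpow_add (by norm_num),
      ← Real.rpow_natCast, ← Real.rpow_mul hX0.le]
    simp; congr 1; ring
  rw [h2]
  gcongr 16 ^ (s/4) * ?_
  exact Real.rpow_le_rpow_of_nonpos hNpos h (by linarith)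

theorem u_le_one (s : ℝ) (hs : 0 < s) (m m' : ℤ) :
    (1 + |(m:ℝ)|) ^ (-s) * (1 + |(m':ℝ)|) ^ (-s) ≤ 1 := by
  have a1 : (1 + |(m:ℝ)|) ^ (-s) ≤ 1 := Real.rpow_le_one_of_one_le_of_nonpos (by simp) (by linarith)
  have a2 : (1 + |(m':ℝ)|) ^ (-s) ≤ 1 := Real.rpow_le_one_of_one_le_of_nonpos (by simp) (by linarith)
  have b2 : 0 ≤ (1 + |(m':ℝ)|) ^ (-s) := by positivity
  nlinarith

theorem int_small (n z B : ℤ) (h : |n * z| ≤ B) (hB : B < |n|) : z = 0 := by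
  by_contra hz
  have h1 : 1 ≤ |z| := Int.one_le_abs hz
  rw [abs_mul] at h
  nlinarith [abs_nonneg n]

theorem pair_T2 (s : ℝ) (hs : 0 < s) : ∃ D : ℝ, ∀ n N : ℤ, N ≠ 0 →
    ∑' a : ℤ, ∑' c : ℤ, (if a * c = N then ENNReal.ofReal
      ((1 + |((n + a : ℤ):ℝ)|) ^ (-s) * (1 + |((n + c : ℤ):ℝ)|) ^ (-s)) else 0) ≤ ENNReal.ofReal D := by
  obtain ⟨C, hC1, hC⟩ := divisor_bound (s/4) (by linarith)
  refine ⟨2 + 2 * 16 ^ (s/4) * C, fun n N hN => ?_⟩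
  have hkey : ∃ L : Finset (ℤ × ℤ), (∀ a c, a * c = N →
      (4 * (max |n + a| |n + c|) ^ 2 < |n|) → (a, c) ∈ L) ∧ L.card ≤ 2 := by
    by_cases h : ∃ a c, a * c = N ∧ 4 * (max |n + a| |n + c|) ^ 2 < |n|
    · obtain ⟨a, c, h1, h2⟩ := h
      refine ⟨{(a, c), (c, a)}, fun a' c' h1' h2' => ?_, Finset.card_le_two⟩
      set M := max |n + a| |n + c| with hM
      set M' := max |n + a'| |n + c'| with hM'
      have k1 : |n + a| ≤ M := le_max_left _ _
      have k2 : |n + c| ≤ M := le_max_right _ _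
      have k3 : |n + a'| ≤ M' := le_max_left _ _
      have k4 : |n + c'| ≤ M' := le_max_right _ _
      have hM0 : 0 ≤ M := (abs_nonneg _).trans k1
      have hM0' : 0 ≤ M' := (abs_nonneg _).trans k3
      have e1 : |(n+a)*(n+c)| ≤ M^2 := by
        rw [abs_mul, sq]; exact mul_le_mul k1 k2 (abs_nonneg _) hM0
      have e2 : |(n+a')*(n+c')| ≤ M'^2 := by
        rw [abs_mul, sq]; exact mul_le_mul k3 k4 (abs_nonneg _) hM0'
      have e3 : n * (a + c - a' - c') = (n+a)*(n+c) - (n+a')*(n+c') := by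
        linear_combination h1' - h1
      have e4 : a + c - a' - c' = 0 := by
        refine int_small n _ (M^2 + M'^2) ?_ (by linarith [abs_nonneg n])
        rw [e3]
        exact (abs_sub _ _).trans (by linarith)
      have e5 : (a' - a) * (a' - c) = 0 := by
        have : c' = a + c - a' := by linarith
        subst this
        linear_combination h1 - h1'
      rcases mul_eq_zero.mp e5 with e | e
      · have : a' = a := by linarith
        have : c' = c := by linarith
        subst_vars; simp
      · have : a' = c := by linarith
        have : c' = a := by linarith
        subst_vars; simp
    · push Not at h
      exact ⟨∅, fun a c h1 h2 => absurd (h a c h1) (not_le.mpr h2), by simp⟩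
  obtain ⟨L, hL, hcard⟩ := hkey
  refine pair_sum (s/4) C hC1 hC (16 ^ (s/4)) (by positivity) _ N hN
    (fun a c => 4 * (max |n + a| |n + c|) ^ 2 < |n|) (fun a c => u_le_one s hs _ _) ?_ L hL hcard
  intro a c hac hg
  refine u_bound s hs _ _ N ?_ hN
  have hg' : (|n|:ℤ) ≤ 4 * (max |n + a| |n + c|) ^ 2 := not_lt.mp hg
  have k : |N| ≤ 16 * (1 + max |n + a| |n + c|) ^ 4 := by
    set M := max |n + a| |n + c| with hM
    have k1 : |n + a| ≤ M := le_max_left _ _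
    have k2 : |n + c| ≤ M := le_max_right _ _
    have hM0 : 0 ≤ M := (abs_nonneg _).trans k1
    have ha : |a| ≤ 4 * (1 + M) ^ 2 := by
      have : |a| ≤ |n + a| + |n| := by
        have := abs_sub (n + a) n; simpa using this
      nlinarith
    have hc : |c| ≤ 4 * (1 + M) ^ 2 := by
      have : |c| ≤ |n + c| + |n| := by
        have := abs_sub (n + c) n; simpa using this
      nlinarith
    rw [← hac, abs_mul]
    calc |a| * |c| ≤ (4 * (1 + M) ^ 2) * (4 * (1 + M) ^ 2) := mul_le_mul ha hc (abs_nonneg _) (by positivity)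
      _ = _ := by ring
  exact_mod_cast k

theorem pair_T1 (s : ℝ) (hs : 0 < s) : ∃ D : ℝ, ∀ n N : ℤ, N ≠ 0 →
    ∑' a : ℤ, ∑' c : ℤ, (if a * c = N then ENNReal.ofReal
      ((1 + |((n + a : ℤ):ℝ)|) ^ (-s) * (1 + |((n + a + c : ℤ):ℝ)|) ^ (-s)) else 0)
        ≤ ENNReal.ofReal D := by
  obtain ⟨C, hC1, hC⟩ := divisor_bound (s/4) (by linarith)
  refine ⟨2 + 2 * 16 ^ (s/4) * C, fun n N hN => ?_⟩
  have hkey : ∃ L : Finset (ℤ × ℤ), (∀ a c, a * c = N →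
      (4 * (max |n + a| |n + a + c|) ^ 2 < |n|) → (a, c) ∈ L) ∧ L.card ≤ 2 := by
    by_cases h : ∃ a c, a * c = N ∧ 4 * (max |n + a| |n + a + c|) ^ 2 < |n|
    · obtain ⟨a, c, h1, h2⟩ := h
      refine ⟨{(a, c)}, fun a' c' h1' h2' => ?_, by simp⟩
      set M := max |n + a| |n + a + c| with hM
      set M' := max |n + a'| |n + a' + c'| with hM'
      have k1 : |n + a| ≤ M := le_max_left _ _
      have k2 : |n + a + c| ≤ M := le_max_right _ _
      have k3 : |n + a'| ≤ M' := le_max_left _ _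
      have k4 : |n + a' + c'| ≤ M' := le_max_right _ _
      have hM0 : 0 ≤ M := (abs_nonneg _).trans k1
      have hM0' : 0 ≤ M' := (abs_nonneg _).trans k3
      have kc : |c| ≤ 2 * M := by
        have := abs_sub (n + a + c) (n + a); simp at this; linarith
      have kc' : |c'| ≤ 2 * M' := by
        have := abs_sub (n + a' + c') (n + a'); simp at this; linarith
      have e1 : |(n+a)*c| ≤ 2*M^2 := by
        rw [abs_mul]
        calc _ ≤ M * (2 * M) := mul_le_mul k1 kc (abs_nonneg _) hM0
          _ = _ := by ring
      have e2 : |(n+a')*c'| ≤ 2*M'^2 := by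
        rw [abs_mul]
        calc _ ≤ M' * (2 * M') := mul_le_mul k3 kc' (abs_nonneg _) hM0'
          _ = _ := by ring
      have e3 : n * (c - c') = (n+a)*c - (n+a')*c' := by
        linear_combination h1' - h1
      have e4 : c - c' = 0 := by
        refine int_small n _ (2*M^2 + 2*M'^2) ?_ (by linarith [abs_nonneg n])
        rw [e3]
        exact (abs_sub _ _).trans (by linarith)
      have e5 : c' = c := by linarith
      subst e5
      have hc : c' ≠ 0 := by rintro rfl; simp at h1; exact hN h1.symm
      have : a' = a := mul_right_cancel₀ hc (h1'.trans h1.symm)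
      subst this; simp
    · push Not at h
      exact ⟨∅, fun a c h1 h2 => absurd (h a c h1) (not_le.mpr h2), by simp⟩
  obtain ⟨L, hL, hcard⟩ := hkey
  refine pair_sum (s/4) C hC1 hC (16 ^ (s/4)) (by positivity) _ N hN
    (fun a c => 4 * (max |n + a| |n + a + c|) ^ 2 < |n|) (fun a c => u_le_one s hs _ _) ?_ L hL hcard
  intro a c hac hg
  refine u_bound s hs _ _ N ?_ hN
  have hg' : (|n|:ℤ) ≤ 4 * (max |n + a| |n + a + c|) ^ 2 := not_lt.mp hg
  have k : |N| ≤ 16 * (1 + max |n + a| |n + a + c|) ^ 4 := by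
    set M := max |n + a| |n + a + c| with hM
    have k1 : |n + a| ≤ M := le_max_left _ _
    have k2 : |n + a + c| ≤ M := le_max_right _ _
    have hM0 : 0 ≤ M := (abs_nonneg _).trans k1
    have ha : |a| ≤ 4 * (1 + M) ^ 2 := by
      have : |a| ≤ |n + a| + |n| := by
        have := abs_sub (n + a) n; simpa using this
      nlinarith
    have hc : |c| ≤ 4 * (1 + M) ^ 2 := by
      have : |c| ≤ |n + a + c| + |n + a| := by
        have := abs_sub (n + a + c) (n + a); simpa using this
      nlinarith
    rw [← hac, abs_mul]
    calc |a| * |c| ≤ (4 * (1 + M) ^ 2) * (4 * (1 + M) ^ 2) := mul_le_mul ha hc (abs_nonneg _) (by positivity)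
      _ = _ := by ring
  exact_mod_cast k


theorem summable_japanese (κ : ℝ) (hκ : 1 < κ) : Summable (fun n : ℤ => (1 + |(n:ℝ)|) ^ (-κ)) := by
  have h1 := Real.summable_abs_int_rpow hκ
  have h2 : Summable (fun n : ℤ => if n = 0 then (1:ℝ) else 0) := by
    apply summable_of_ne_finset_zero (s := {0}); intro b hb; simp at hb; simp [hb]
  refine Summable.of_nonneg_of_le (fun n => by positivity) (fun n => ?_) (h1.add h2)
  by_cases h : n = 0
  · subst h; simp; positivity
  · simp only [h, if_false, add_zero]
    apply Real.rpow_le_rpow_of_nonpos (by positivity) (by linarith) (by linarith)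

theorem tsum_japanese (κ : ℝ) (hκ : 1 < κ) : ∃ Z : ℝ, ∑' n : ℤ, ENNReal.ofReal ((1 + |(n:ℝ)|) ^ (-κ)) = ENNReal.ofReal Z :=
  ⟨_, (ENNReal.ofReal_tsum_of_nonneg (fun n => by positivity) (summable_japanese κ hκ)).symm⟩

theorem int_shift_sum (κ : ℝ) (hκ : 1 < κ) : ∃ Z : ℝ, ∀ x : ℝ,
    ∑' N : ℤ, ENNReal.ofReal ((1 + |x - 4 * Real.pi * N|) ^ (-κ)) ≤ ENNReal.ofReal Z := by
  obtain ⟨Z, hZ⟩ := tsum_japanese κ hκ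
  refine ⟨2 ^ κ * Z, fun x => ?_⟩
  set r : ℤ := round (x / (4 * Real.pi)) with hr
  have hpi := Real.pi_gt_three
  have key : ∀ N : ℤ, (1 + |x - 4 * Real.pi * N|) ^ (-κ) ≤ 2 ^ κ * (1 + |((N - r : ℤ) : ℝ)|) ^ (-κ) := by
    intro N
    have h1 : |x / (4 * Real.pi) - r| ≤ 1/2 := abs_sub_round _
    have h2 : |((N - r : ℤ) : ℝ)| ≤ |x / (4 * Real.pi) - N| + 1/2 := by
      push_cast
      calc |(N:ℝ) - r| = |(x / (4 * Real.pi) - r) - (x / (4 * Real.pi) - N)| := by congr 1; ring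
        _ ≤ _ := by linarith [abs_sub (x / (4 * Real.pi) - r) (x / (4 * Real.pi) - N)]
    have h3 : |x / (4 * Real.pi) - N| ≤ |x - 4 * Real.pi * N| := by
      have : x - 4 * Real.pi * N = (4 * Real.pi) * (x / (4 * Real.pi) - N) := by field_simp
      rw [this, abs_mul, abs_of_pos (by positivity : 0 < 4 * Real.pi)]
      nlinarith [abs_nonneg (x / (4 * Real.pi) - N)]
    have h4 : 2⁻¹ * (1 + |((N - r : ℤ) : ℝ)|) ≤ 1 + |x - 4 * Real.pi * N| := by
      linarith [abs_nonneg (x / (4 * Real.pi) - N)]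
    calc (1 + |x - 4 * Real.pi * N|) ^ (-κ) ≤ (2⁻¹ * (1 + |((N - r : ℤ) : ℝ)|)) ^ (-κ) :=
          Real.rpow_le_rpow_of_nonpos (by positivity) h4 (by linarith)
      _ = _ := by
          rw [Real.mul_rpow (by norm_num) (by positivity), Real.inv_rpow (by norm_num), Real.rpow_neg (by norm_num), inv_inv]
  calc _ ≤ ∑' N : ℤ, ENNReal.ofReal (2 ^ κ) * ENNReal.ofReal ((1 + |((N - r : ℤ) : ℝ)|) ^ (-κ)) := by
        refine ENNReal.tsum_le_tsum fun N => ?_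
        rw [← ENNReal.ofReal_mul (by positivity)]
        exact ENNReal.ofReal_le_ofReal (key N)
    _ = ENNReal.ofReal (2 ^ κ) * ENNReal.ofReal Z := by
        rw [ENNReal.tsum_mul_left, ← hZ]
        congr 1
        exact (Equiv.subRight r).tsum_eq (fun n : ℤ => ENNReal.ofReal ((1 + |(n:ℝ)|) ^ (-κ)))
    _ = _ := by rw [ENNReal.ofReal_mul (by positivity)]

theorem abstract_sum (p q θ κ : ℝ) (hpq : p.HolderConjugate q) (hκ : κ = θ * q)
    (u : ℤ → ℤ → ℝ) (hu0 : ∀ a c, 0 ≤ u a c) (hu1 : ∀ a c, u a c ≤ 1)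
    (D D2 Z : ℝ) (hD : ∀ N : ℤ, N ≠ 0 → ∑' a : ℤ, ∑' c : ℤ, (if a * c = N then ENNReal.ofReal (u a c) else 0)
        ≤ ENNReal.ofReal D)
    (hD2 : ∑' a : ℤ, ∑' c : ℤ, ENNReal.ofReal (u a c ^ p) ≤ ENNReal.ofReal D2)
    (x : ℝ) (hZ : ∑' N : ℤ, ENNReal.ofReal ((1 + |x - 4 * Real.pi * N|) ^ (-κ)) ≤ ENNReal.ofReal Z) :
    ∑' a : ℤ, ∑' c : ℤ, (if a = 0 ∨ c = 0 then 0 else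
      ENNReal.ofReal ((u a c) ^ 2 * (1 + |x - 4 * Real.pi * (a * c : ℤ)|) ^ (-θ))) ≤
    ENNReal.ofReal D2 + ENNReal.ofReal D * ENNReal.ofReal Z := by
  have hq1 : 1 < q := hpq.symm.lt
  have hp1 : 1 < p := hpq.lt
  have pt : ∀ a c : ℤ, (if a = 0 ∨ c = 0 then 0 else
      ENNReal.ofReal ((u a c) ^ 2 * (1 + |x - 4 * Real.pi * (a * c : ℤ)|) ^ (-θ))) ≤
      ENNReal.ofReal (u a c ^ p) + ∑' N : ℤ, ENNReal.ofReal ((1 + |x - 4 * Real.pi * N|) ^ (-κ)) *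
        (if N ≠ 0 then (if a * c = N then ENNReal.ofReal (u a c) else 0) else 0) := by
    intro a c
    split_ifs with h
    · exact zero_le
    · push Not at h
      have hN : a * c ≠ 0 := mul_ne_zero h.1 h.2
      refine le_trans ?_ (add_le_add_right (ENNReal.le_tsum (a * c)) _)
      simp only [hN, ne_eq, not_false_eq_true, if_true]
      rw [← ENNReal.ofReal_mul (by positivity), ← ENNReal.ofReal_add (Real.rpow_nonneg (hu0 _ _) _)
        (mul_nonneg (by positivity) (hu0 _ _))]
      apply ENNReal.ofReal_le_ofReal
      set y := (1 + |x - 4 * Real.pi * (a * c : ℤ)|) with hy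
      have hy0 : 0 < y := by positivity
      have h0 := hu0 a c
      have hY := Real.young_inequality_of_nonneg (hu0 a c) (mul_nonneg (hu0 a c) (Real.rpow_nonneg hy0.le (-θ))) hpq
      have e1 : u a c ^ p / p ≤ u a c ^ p := div_le_self (Real.rpow_nonneg (hu0 _ _) _) hp1.le
      have e2 : (u a c * y ^ (-θ)) ^ q / q ≤ y ^ (-κ) * u a c := by
        refine (div_le_self (by positivity) hq1.le).trans ?_
        rw [Real.mul_rpow (hu0 _ _) (by positivity), ← Real.rpow_mul hy0.le, mul_comm, hκ, neg_mul]
        gcongr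
        calc u a c ^ q ≤ u a c ^ (1:ℝ) := Real.rpow_le_rpow_of_exponent_ge' (hu0 _ _) (hu1 _ _) (by norm_num) hq1.le
          _ = _ := Real.rpow_one _
      calc u a c ^ 2 * y ^ (-θ) = u a c * (u a c * y ^ (-θ)) := by ring
        _ ≤ _ := by linarith
  calc _ ≤ ∑' a : ℤ, ∑' c : ℤ, (ENNReal.ofReal (u a c ^ p) + ∑' N : ℤ, ENNReal.ofReal ((1 + |x - 4 * Real.pi * N|) ^ (-κ)) *
        (if N ≠ 0 then (if a * c = N then ENNReal.ofReal (u a c) else 0) else 0)) :=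
        ENNReal.tsum_le_tsum fun a => ENNReal.tsum_le_tsum fun c => pt a c
    _ = (∑' a : ℤ, ∑' c : ℤ, ENNReal.ofReal (u a c ^ p)) +
        ∑' N : ℤ, ENNReal.ofReal ((1 + |x - 4 * Real.pi * N|) ^ (-κ)) *
         ∑' a : ℤ, ∑' c : ℤ, (if N ≠ 0 then (if a * c = N then ENNReal.ofReal (u a c) else 0) else 0) := by
        simp_rw [ENNReal.tsum_add]
        congr 1
        simp_rw [← ENNReal.tsum_mul_left]
        rw [ENNReal.tsum_comm]
        conv_rhs => rw [ENNReal.tsum_comm]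
        rw [ENNReal.tsum_comm]
        refine tsum_congr fun a => ?_
        rw [ENNReal.tsum_comm]
    _ ≤ ENNReal.ofReal D2 + ∑' N : ℤ, ENNReal.ofReal ((1 + |x - 4 * Real.pi * N|) ^ (-κ)) * ENNReal.ofReal D := by
        gcongr with N
        by_cases h : N = 0
        · simp [h]
        · simp only [h, ne_eq, not_false_eq_true, if_true]; exact hD N h
    _ ≤ _ := by
        rw [ENNReal.tsum_mul_right, mul_comm]
        gcongr

/-- the two counting estimates -/
theorem count_both (s : ℝ) (hs : 0 < s) : ∃ θ : ℝ, 0 < θ ∧ θ < 1 ∧ ∃ K : ℝ, 0 < K ∧ ∀ (n : ℤ) (x : ℝ),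
    (∑' a : ℤ, ∑' c : ℤ, (if a = 0 ∨ c = 0 then 0 else
      ENNReal.ofReal (((1 + |((n + a : ℤ):ℝ)|) ^ (-s) * (1 + |((n + c : ℤ):ℝ)|) ^ (-s)) ^ 2 *
        (1 + |x - 4 * Real.pi * (a * c : ℤ)|) ^ (-θ))) ≤ ENNReal.ofReal K) ∧
    (∑' a : ℤ, ∑' c : ℤ, (if a = 0 ∨ c = 0 then 0 else
      ENNReal.ofReal (((1 + |((n + a : ℤ):ℝ)|) ^ (-s) * (1 + |((n + a + c : ℤ):ℝ)|) ^ (-s)) ^ 2 *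
        (1 + |x - 4 * Real.pi * (a * c : ℤ)|) ^ (-θ))) ≤ ENNReal.ofReal K) := by
  set p : ℝ := 2 + 2 / s with hp
  have hp2 : 2 < p := by have : 0 < 2 / s := by positivity
                         linarith
  have hsp : 1 < s * p := by rw [hp]; field_simp; linarith
  have hpq : p.HolderConjugate p.conjExponent := Real.HolderConjugate.conjExponent (by linarith)
  set q := p.conjExponent with hq
  set θ : ℝ := 1 - 1 / (2 * p) with hθ
  have hκ : 1 < θ * q := by
    rw [hq, Real.conjExponent, hθ]
    rw [show (1 - 1 / (2 * p)) * (p / (p - 1)) = (p - 1/2) / (p - 1) by field_simp]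
    rw [lt_div_iff₀ (by linarith)]; linarith
  obtain ⟨Z, hZ⟩ := int_shift_sum (θ * q) hκ
  obtain ⟨Z2, hZ2⟩ := tsum_japanese (s * p) hsp
  obtain ⟨D1, hD1⟩ := pair_T1 s hs
  obtain ⟨D2, hD2⟩ := pair_T2 s hs
  have hJ : ∀ m m' : ℤ, ENNReal.ofReal (((1 + |(m:ℝ)|) ^ (-s) * (1 + |(m':ℝ)|) ^ (-s)) ^ p) =
      ENNReal.ofReal ((1 + |(m:ℝ)|) ^ (-(s * p))) * ENNReal.ofReal ((1 + |(m':ℝ)|) ^ (-(s * p))) := by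
    intro m m'
    rw [← ENNReal.ofReal_mul (by positivity), Real.mul_rpow (by positivity) (by positivity),
      ← Real.rpow_mul (by positivity), ← Real.rpow_mul (by positivity), neg_mul]
  have hpinv : 1 / (2 * p) < 1 := by rw [div_lt_one (by linarith)]; linarith
  have hpinv0 : 0 < 1 / (2 * p) := by positivity
  have shift : ∀ m : ℤ, ∑' a : ℤ, ENNReal.ofReal ((1 + |((m + a : ℤ):ℝ)|) ^ (-(s * p))) = ENNReal.ofReal Z2 := by
    intro m
    rw [← hZ2]
    exact (Equiv.addLeft m).tsum_eq (fun n : ℤ => ENNReal.ofReal ((1 + |(n:ℝ)|) ^ (-(s * p))))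
  have fin : ∀ D : ℝ, ENNReal.ofReal (Z2 ^ 2) + ENNReal.ofReal D * ENNReal.ofReal Z ≤
      ENNReal.ofReal (Z2 ^ 2 + |D| * |Z|) := by
    intro D
    rw [ENNReal.ofReal_add (by positivity) (by positivity), ENNReal.ofReal_mul (by positivity)]
    gcongr <;> exact le_abs_self _
  refine ⟨θ, by rw [hθ]; linarith, by rw [hθ]; linarith, max (Z2 ^ 2 + |D2| * |Z|) (Z2 ^ 2 + |D1| * |Z|) + 1, by positivity, fun n x => ⟨?_, ?_⟩⟩
  · refine (abstract_sum p q θ (θ * q) hpq rfl _ (fun a c => by positivity) (fun a c => u_le_one s hs _ _) D2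
      (Z2 ^ 2) Z (hD2 n) ?_ x (hZ x)).trans ((fin D2).trans (ENNReal.ofReal_le_ofReal ?_))
    · simp_rw [hJ, ENNReal.tsum_mul_left, ENNReal.tsum_mul_right, shift]
      rw [sq, ENNReal.ofReal_mul']
      by_contra h
      simp [ENNReal.ofReal_of_nonpos (not_le.mp h).le] at hZ2
      have := hZ2 0; norm_num at this
    · linarith [le_max_left (Z2 ^ 2 + |D2| * |Z|) (Z2 ^ 2 + |D1| * |Z|)]
  · refine (abstract_sum p q θ (θ * q) hpq rfl _ (fun a c => by positivity) (fun a c => u_le_one s hs _ _) D1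
      (Z2 ^ 2) Z (hD1 n) ?_ x (hZ x)).trans ((fin D1).trans (ENNReal.ofReal_le_ofReal ?_))
    · simp_rw [hJ, ENNReal.tsum_mul_left, shift, ENNReal.tsum_mul_right, shift]
      rw [sq, ENNReal.ofReal_mul']
      by_contra h
      simp [ENNReal.ofReal_of_nonpos (not_le.mp h).le] at hZ2
      have := hZ2 0; norm_num at this
    · linarith [le_max_right (Z2 ^ 2 + |D2| * |Z|) (Z2 ^ 2 + |D1| * |Z|)]


/-- `⟨y⟩^{-θ}` in `ℝ≥0∞`. -/
noncomputable def rho (θ y : ℝ) : ℝ≥0∞ := ENNReal.ofReal ((1 + |y|) ^ (-θ))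

theorem rho_measurable (θ : ℝ) : Measurable (rho θ) := by
  unfold rho; fun_prop

theorem rho_le_one (θ y : ℝ) (h : 0 ≤ θ) : rho θ y ≤ 1 := by
  unfold rho
  exact ENNReal.ofReal_le_one.mpr (Real.rpow_le_one_of_one_le_of_nonpos (by simp) (by linarith))

theorem rho_anti {θ θ' : ℝ} (h : θ ≤ θ') (y : ℝ) : rho θ' y ≤ rho θ y := by
  unfold rho
  apply ENNReal.ofReal_le_ofReal
  exact Real.rpow_le_rpow_of_exponent_le (by simp) (by linarith)

theorem rho_neg (θ y : ℝ) : rho θ (-y) = rho θ y := by simp [rho]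

theorem rho_lint (r : ℝ) (hr : 1 < r) : ∃ C : ℝ, 0 < C ∧ ∫⁻ x, rho r x = ENNReal.ofReal C := by
  have h := integrable_one_add_norm (E := ℝ) (μ := volume) (r := r) (by simpa using hr)
  have h2 := ofReal_integral_eq_lintegral_ofReal h (Filter.Eventually.of_forall fun x => by positivity)
  refine ⟨_, ?_, h2.symm⟩
  rw [integral_pos_iff_support_of_nonneg (fun x => by positivity) h]
  have : (Function.support fun x : ℝ => (1 + ‖x‖) ^ (-r)) = Set.univ := by
    ext x; simp only [Function.mem_support, Set.mem_univ, iff_true]; positivity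
  rw [this]; simp

theorem rho_pt (α κ : ℝ) (hκ : 0 ≤ κ) (hακ : κ ≤ α) (x z : ℝ) :
    rho α x * rho α z ≤ ENNReal.ofReal (2 ^ (α - κ)) * rho (α - κ) (x + z) *
      (rho (α + κ) x + rho (α + κ) z) := by
  wlog h : |x| ≤ |z| generalizing x z
  · have := this z x (le_of_not_ge h)
    rw [mul_comm, add_comm x z, add_comm (rho (α + κ) x)]; exact this
  refine le_trans ?_ (mul_le_mul_right (le_add_right le_rfl) _)
  unfold rho
  rw [← ENNReal.ofReal_mul (by positivity), ← ENNReal.ofReal_mul (by positivity),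
    ← ENNReal.ofReal_mul (by positivity)]
  apply ENNReal.ofReal_le_ofReal
  have h1 : 1 + |x + z| ≤ 2 * (1 + |z|) := by linarith [abs_add_le x z]
  have e1 : (1 + |z|) ^ (-α) = (1 + |z|) ^ (-(α - κ)) * (1 + |z|) ^ (-κ) := by
    rw [← Real.rpow_add (by positivity)]; congr 1; ring
  have e2 : (1 + |x|) ^ (-(α + κ)) = (1 + |x|) ^ (-α) * (1 + |x|) ^ (-κ) := by
    rw [← Real.rpow_add (by positivity)]; congr 1; ring
  have e3 : (1 + |z|) ^ (-κ) ≤ (1 + |x|) ^ (-κ) :=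
    Real.rpow_le_rpow_of_nonpos (by positivity) (by linarith) (by linarith)
  have e4 : (1 + |z|) ^ (-(α - κ)) ≤ 2 ^ (α - κ) * (1 + |x + z|) ^ (-(α - κ)) := by
    calc (1 + |z|) ^ (-(α - κ)) = 2 ^ (α - κ) * (2 * (1 + |z|)) ^ (-(α - κ)) := by
          rw [Real.mul_rpow (by norm_num) (by positivity), ← mul_assoc, ← Real.rpow_add (by norm_num)]; simp
      _ ≤ _ := by
          gcongr 2 ^ (α - κ) * ?_
          exact Real.rpow_le_rpow_of_nonpos (by positivity) h1 (by linarith)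
  rw [e1, e2]
  calc (1 + |x|) ^ (-α) * ((1 + |z|) ^ (-(α - κ)) * (1 + |z|) ^ (-κ))
      ≤ (1 + |x|) ^ (-α) * ((2 ^ (α - κ) * (1 + |x + z|) ^ (-(α - κ))) * (1 + |x|) ^ (-κ)) := by gcongr
    _ = _ := by ring

theorem rho_conv (α κ : ℝ) (hκ : 0 ≤ κ) (hακ : κ ≤ α) (h1 : 1 < α + κ) : ∃ C : ℝ, 0 < C ∧ ∀ u z : ℝ,
    ∫⁻ x, rho α (x + u) * rho α (z - x) ≤ ENNReal.ofReal C * rho (α - κ) (z + u) := by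
  obtain ⟨C, hC, hCe⟩ := rho_lint (α + κ) h1
  refine ⟨2 ^ (α - κ) * (C + C), by positivity, fun u z => ?_⟩
  have hm := rho_measurable (α + κ)
  calc _ ≤ ∫⁻ x, ENNReal.ofReal (2 ^ (α - κ)) * rho (α - κ) (z + u) *
      (rho (α + κ) (x + u) + rho (α + κ) (z - x)) := by
        refine lintegral_mono fun x => ?_
        have := rho_pt α κ hκ hακ (x + u) (z - x)
        rwa [show x + u + (z - x) = z + u by ring] at this
    _ = _ := by
        rw [lintegral_const_mul _ (by fun_prop), lintegral_add_left (by fun_prop),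
          lintegral_add_right_eq_self (rho (α + κ)) u, lintegral_sub_left_eq_self (rho (α + κ)) z, hCe,
          ENNReal.ofReal_mul (by positivity), ENNReal.ofReal_add hC.le hC.le]
        ring

theorem rho_conv3 (θ ε : ℝ) (hθ : 0 < θ) (hε : 0 < ε) (hεθ : θ ≤ 1 - 11 * ε) : ∃ C : ℝ, 0 < C ∧ ∀ u v w τ : ℝ,
    ∫⁻ x, ∫⁻ y, rho (1 - 2 * ε) (x + u) * (rho (1 - 2 * ε) (y + v) * rho (1 - 2 * ε) (τ - x - y + w)) ≤
      ENNReal.ofReal C * rho θ (τ + u + v + w) := by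
  obtain ⟨C1, h1, H1⟩ := rho_conv (1 - 2 * ε) (3 * ε) (by linarith) (by linarith) (by linarith)
  obtain ⟨C2, h2, H2⟩ := rho_conv (1 - 5 * ε) (6 * ε) (by linarith) (by linarith) (by linarith)
  refine ⟨C1 * C2, by positivity, fun u v w τ => ?_⟩
  have hm1 := rho_measurable (1 - 2 * ε)
  have hm2 := rho_measurable (1 - 5 * ε)
  calc _ ≤ ∫⁻ x, ENNReal.ofReal C1 * (rho (1 - 5 * ε) (x + u) * rho (1 - 5 * ε) ((τ + w + v) - x)) := by
        refine lintegral_mono fun x => ?_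
        rw [lintegral_const_mul _ (by fun_prop)]
        have e := H1 v (τ - x + w)
        have : ∀ y, τ - x - y + w = τ - x + w - y := fun y => by ring
        simp_rw [this]
        rw [show 1 - 2 * ε - 3 * ε = 1 - 5 * ε by ring, show τ - x + w + v = (τ + w + v) - x by ring] at e
        calc _ ≤ rho (1 - 5 * ε) (x + u) * (ENNReal.ofReal C1 * rho (1 - 5 * ε) ((τ + w + v) - x)) := by
              gcongr
              exact rho_anti (by linarith) _
          _ = _ := by ring
    _ ≤ ENNReal.ofReal C1 * (ENNReal.ofReal C2 * rho θ (τ + u + v + w)) := by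
        rw [lintegral_const_mul _ (by fun_prop)]
        gcongr
        refine (H2 u (τ + w + v)).trans ?_
        rw [show τ + w + v + u = τ + u + v + w by ring]
        gcongr
        exact rho_anti (by linarith) _
    _ = _ := by rw [ENNReal.ofReal_mul h1.le, mul_assoc]


theorem cs' {X : Type*} [MeasurableSpace X] (μ : Measure X) (h f g : X → ℝ≥0∞)
    (hf : AEMeasurable f μ) (hg : AEMeasurable g μ) (H : ∀ x, h x ^ 2 ≤ f x * g x) :
    (∫⁻ x, h x ∂μ) ^ 2 ≤ (∫⁻ x, f x ∂μ) * ∫⁻ x, g x ∂μ := by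
  have h1 : ∀ x, h x ≤ f x ^ (1/2:ℝ) * g x ^ (1/2:ℝ) := by
    intro x
    rw [← ENNReal.mul_rpow_of_nonneg _ _ (by norm_num)]
    calc h x = (h x ^ 2) ^ (1/2:ℝ) := by
          rw [← ENNReal.rpow_natCast, ← ENNReal.rpow_mul]; norm_num
      _ ≤ _ := by gcongr; exact H x
  have h2 := ENNReal.lintegral_mul_le_Lp_mul_Lq μ Real.HolderConjugate.two_two
    (hf.pow_const (1/2:ℝ)) (hg.pow_const (1/2:ℝ))
  have h3 : ∀ y : ℝ≥0∞, (y ^ (1/2:ℝ)) ^ (2:ℝ) = y := by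
    intro y; rw [← ENNReal.rpow_mul]; norm_num
  simp only [h3, Pi.mul_apply] at h2
  calc (∫⁻ x, h x ∂μ) ^ 2 ≤ ((∫⁻ x, f x ∂μ) ^ (1/2:ℝ) * (∫⁻ x, g x ∂μ) ^ (1/2:ℝ)) ^ 2 := by
        gcongr; exact (lintegral_mono h1).trans h2
    _ = _ := by
        rw [← ENNReal.rpow_natCast, ENNReal.mul_rpow_of_nonneg _ _ (by norm_num)]
        simp only [Nat.cast_ofNat, h3]

theorem cs_tsum {ι : Type*} [Countable ι] (h f g : ι → ℝ≥0∞) (H : ∀ x, h x ^ 2 ≤ f x * g x) :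
    (∑' x, h x) ^ 2 ≤ (∑' x, f x) * ∑' x, g x := by
  let _ : MeasurableSpace ι := ⊤
  have := cs' Measure.count h f g (measurable_from_top).aemeasurable (measurable_from_top).aemeasurable H
  simpa [lintegral_count] using this

theorem sq_le_iff (a b : ℝ≥0∞) : a ^ 2 ≤ b ^ 2 ↔ a ≤ b := by
  constructor
  · intro h
    by_contra hc
    exact absurd h (not_le.mpr (ENNReal.pow_lt_pow_left (by norm_num) (not_le.mp hc)))
  · intro h; gcongr

theorem mink {ι : Type*} [Countable ι] {X : Type*} [MeasurableSpace X] (μ : Measure X)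
    (T : ι → X → ℝ≥0∞) (hT : ∀ i, Measurable (T i)) (y z : ι → ℝ≥0∞)
    (H : ∀ i, ∫⁻ x, T i x ^ 2 ∂μ ≤ y i * z i) :
    ∫⁻ x, (∑' i, T i x) ^ 2 ∂μ ≤ (∑' i, y i) * ∑' i, z i := by
  set r : ι → ℝ≥0∞ := fun i => (y i * z i) ^ (1/2:ℝ) with hr
  have hr2 : ∀ i, r i ^ 2 = y i * z i := by
    intro i; rw [hr, ← ENNReal.rpow_natCast, ← ENNReal.rpow_mul]; norm_num
  have h1 : ∀ i j, ∫⁻ x, T i x * T j x ∂μ ≤ r i * r j := by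
    intro i j
    rw [← sq_le_iff, mul_pow, hr2, hr2]
    refine (cs' μ (fun x => T i x * T j x) (fun x => T i x ^ 2) (fun x => T j x ^ 2) ?_ ?_ ?_).trans ?_
    · exact ((hT i).pow_const 2).aemeasurable
    · exact ((hT j).pow_const 2).aemeasurable
    · intro x; rw [mul_pow]
    · exact mul_le_mul' (H i) (H j)
  calc ∫⁻ x, (∑' i, T i x) ^ 2 ∂μ = ∑' i, ∑' j, ∫⁻ x, T i x * T j x ∂μ := by
        have : ∀ x, (∑' i, T i x) ^ 2 = ∑' i, ∑' j, T i x * T j x := by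
          intro x
          simp_rw [ENNReal.tsum_mul_left, ENNReal.tsum_mul_right, sq]
        simp_rw [this]
        rw [lintegral_tsum]
        · refine tsum_congr fun i => ?_
          rw [lintegral_tsum]
          intro j; exact ((hT i).mul (hT j)).aemeasurable
        · intro i; exact (Measurable.tsum fun j => (hT i).mul (hT j)).aemeasurable
    _ ≤ ∑' i, ∑' j, r i * r j := ENNReal.tsum_le_tsum fun i => ENNReal.tsum_le_tsum fun j => h1 i j
    _ = (∑' i, r i) ^ 2 := by simp_rw [ENNReal.tsum_mul_left, ENNReal.tsum_mul_right, sq]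
    _ ≤ _ := cs_tsum r y z fun i => (hr2 i).le

theorem three_sq (x y z : ℝ≥0∞) : (x + y + z) ^ 2 ≤ 9 * (x ^ 2 + y ^ 2 + z ^ 2) := by
  set m := max x (max y z) with hm
  have h : x + y + z ≤ 3 * m := by
    have hx : x ≤ m := le_max_left _ _
    have hy : y ≤ m := (le_max_left _ _).trans (le_max_right _ _)
    have hz : z ≤ m := (le_max_right _ _).trans (le_max_right _ _)
    calc x + y + z ≤ m + m + m := by gcongr
      _ = _ := by ring
  calc (x + y + z) ^ 2 ≤ (3 * m) ^ 2 := by gcongr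
    _ = 9 * m ^ 2 := by ring
    _ ≤ _ := by
        gcongr
        rcases max_choice x (max y z) with h' | h'
        · rw [hm, h', add_assoc]; exact le_add_right le_rfl
        · rcases max_choice y z with h'' | h''
          · rw [hm, h', h'']; exact le_add_right (le_add_left le_rfl)
          · rw [hm, h', h'']; exact le_add_left le_rfl

/-- time-trilinear form -/
noncomputable def tconv (F1 F3 F2 : ℝ → ℝ≥0∞) (τ : ℝ) : ℝ≥0∞ :=
  ∫⁻ x, ∫⁻ y, F1 x * (F3 y * F2 (τ - x - y))

theorem tconv_measurable {F1 F3 F2 : ℝ → ℝ≥0∞} (h1 : Measurable F1) (h3 : Measurable F3)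
    (h2 : Measurable F2) : Measurable (tconv F1 F3 F2) := by
  unfold tconv
  fun_prop

theorem tconv_lintegral {F1 F3 F2 : ℝ → ℝ≥0∞} (h1 : Measurable F1) (h3 : Measurable F3)
    (h2 : Measurable F2) : ∫⁻ τ, tconv F1 F3 F2 τ = (∫⁻ x, F1 x) * ((∫⁻ x, F3 x) * ∫⁻ x, F2 x) := by
  unfold tconv
  rw [lintegral_lintegral_swap (by fun_prop)]
  rw [← lintegral_mul_const _ h1]
  refine lintegral_congr fun x => ?_
  rw [lintegral_lintegral_swap (by fun_prop)]
  rw [← lintegral_mul_const _ h3, ← lintegral_const_mul _ (by fun_prop)]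
  refine lintegral_congr fun y => ?_
  rw [lintegral_const_mul _ (by fun_prop), lintegral_const_mul _ (by fun_prop)]
  congr 2
  simp_rw [sub_sub]
  exact lintegral_sub_right_eq_self F2 (x + y)

theorem tconv_cs {F1 F3 F2 p1 p3 p2 : ℝ → ℝ≥0∞} (h1 : Measurable F1) (h3 : Measurable F3)
    (h2 : Measurable F2) (k1 : Measurable p1) (k3 : Measurable p3) (k2 : Measurable p2) (τ : ℝ) :
    tconv (fun x => p1 x * F1 x) (fun x => p3 x * F3 x) (fun x => p2 x * F2 x) τ ^ 2 ≤
    tconv (fun x => p1 x ^ 2) (fun x => p3 x ^ 2) (fun x => p2 x ^ 2) τ *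
    tconv (fun x => F1 x ^ 2) (fun x => F3 x ^ 2) (fun x => F2 x ^ 2) τ := by
  unfold tconv
  have pr : ∀ g : ℝ → ℝ → ℝ≥0∞, Measurable (Function.uncurry g) →
      ∫⁻ x, ∫⁻ y, g x y = ∫⁻ z : ℝ × ℝ, g z.1 z.2 ∂(volume.prod volume) := by
    intro g hg; exact (lintegral_prod _ hg.aemeasurable).symm
  rw [pr (fun x y => p1 x * F1 x * (p3 y * F3 y * (p2 (τ - x - y) * F2 (τ - x - y)))) (by fun_prop),
    pr (fun x y => p1 x ^ 2 * (p3 y ^ 2 * (p2 (τ - x - y) ^ 2))) (by fun_prop),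
    pr (fun x y => F1 x ^ 2 * (F3 y ^ 2 * (F2 (τ - x - y) ^ 2))) (by fun_prop)]
  refine cs' _ _ _ _ (by fun_prop) (by fun_prop) fun x => le_of_eq (by ring)


theorem rho_sq (b y : ℝ) : rho b y ^ 2 = rho (2 * b) y := by
  unfold rho
  rw [← ENNReal.ofReal_pow (by positivity), ← Real.rpow_natCast, ← Real.rpow_mul (by positivity)]
  congr 2; push_cast; ring

theorem tconv_smul (j1 j3 j2 : ℝ≥0∞) {F1 F3 F2 : ℝ → ℝ≥0∞} (h1 : Measurable F1) (h3 : Measurable F3)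
    (h2 : Measurable F2) (τ : ℝ) :
    tconv (fun x => j1 * F1 x) (fun x => j3 * F3 x) (fun x => j2 * F2 x) τ =
      j1 * j3 * j2 * tconv F1 F3 F2 τ := by
  unfold tconv
  rw [← lintegral_const_mul _ (by fun_prop)]
  refine lintegral_congr fun x => ?_
  rw [← lintegral_const_mul _ (by fun_prop)]
  refine lintegral_congr fun y => ?_
  ring

theorem tri_core (θ ε C : ℝ) (hθ : 0 ≤ θ) (K : ℝ≥0∞)
    (hconv : ∀ u v w τ : ℝ,
      ∫⁻ x, ∫⁻ y, rho (1 - 2 * ε) (x + u) * (rho (1 - 2 * ε) (y + v) * rho (1 - 2 * ε) (τ - x - y + w)) ≤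
      ENNReal.ofReal C * rho θ (τ + u + v + w))
    (j1 j3 j2 : ℤ → ℝ≥0∞) (hj1 : ∀ k, j1 k ≤ 1) (hj3 : ∀ k, j3 k ≤ 1) (hj2 : ∀ k, j2 k ≤ 1)
    (hcount : ∀ (n : ℤ) (x : ℝ), ∑' a : ℤ, ∑' c : ℤ, (if a = 0 ∨ c = 0 then 0 else
      (j1 (n + a) * j3 (n + c) * j2 (-(n + a + c))) ^ 2 * rho θ (x - 4 * Real.pi * (a * c : ℤ))) ≤ K)
    (f1 f3 f2 : ℤ → ℝ → ℝ≥0∞) (hf1 : ∀ k, Measurable (f1 k)) (hf3 : ∀ k, Measurable (f3 k))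
    (hf2 : ∀ k, Measurable (f2 k)) :
    ∑' n : ℤ, ∫⁻ τ, (∑' k1 : ℤ, ∑' k3 : ℤ, tconv
      (fun x => j1 k1 * (rho (1/2 - ε) (x + 2 * Real.pi * (k1:ℝ) ^ 2) * f1 k1 x))
      (fun x => j3 k3 * (rho (1/2 - ε) (x + 2 * Real.pi * (k3:ℝ) ^ 2) * f3 k3 x))
      (fun x => j2 (n - k1 - k3) * (rho (1/2 - ε) (x - 2 * Real.pi * ((n - k1 - k3 : ℤ):ℝ) ^ 2) * f2 (n - k1 - k3) x)) τ) ^ 2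
    ≤ 9 * (ENNReal.ofReal C * (K + 2)) * ((∑' k, ∫⁻ x, f1 k x ^ 2) * ((∑' k, ∫⁻ x, f3 k x ^ 2) *
       (∑' k, ∫⁻ x, f2 k x ^ 2))) := by
  have hrm := rho_measurable (1/2 - ε)
  have hrm' := rho_measurable θ
  set g1 : ℤ → ℝ≥0∞ := fun k => ∫⁻ x, f1 k x ^ 2 with hg1
  set g3 : ℤ → ℝ≥0∞ := fun k => ∫⁻ x, f3 k x ^ 2 with hg3
  set g2 : ℤ → ℝ≥0∞ := fun k => ∫⁻ x, f2 k x ^ 2 with hg2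
  set B : ℤ → ℤ → ℤ → ℝ → ℝ≥0∞ := fun n a c => tconv
      (fun x => rho (1/2 - ε) (x + 2 * Real.pi * ((n + a : ℤ):ℝ) ^ 2) * f1 (n + a) x)
      (fun x => rho (1/2 - ε) (x + 2 * Real.pi * ((n + c : ℤ):ℝ) ^ 2) * f3 (n + c) x)
      (fun x => rho (1/2 - ε) (x - 2 * Real.pi * ((-(n + a + c) : ℤ):ℝ) ^ 2) * f2 (-(n + a + c)) x) with hB
  set E : ℤ → ℤ → ℤ → ℝ → ℝ≥0∞ := fun n a c => tconv (fun x => f1 (n + a) x ^ 2)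
      (fun x => f3 (n + c) x ^ 2) (fun x => f2 (-(n + a + c)) x ^ 2) with hE
  set w : ℤ → ℤ → ℤ → ℝ≥0∞ := fun n a c => j1 (n + a) * j3 (n + c) * j2 (-(n + a + c)) with hw
  have hw1 : ∀ n a c, w n a c ≤ 1 := by
    intro n a c
    calc w n a c ≤ 1 * 1 * 1 := by
          rw [hw]; dsimp only; gcongr <;> simp [hj1, hj3, hj2]
      _ = 1 := by simp
  have hBm : ∀ n a c, Measurable (B n a c) := fun n a c => by
    have := hf1 (n+a); have := hf3 (n+c); have := hf2 (-(n+a+c))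
    exact tconv_measurable (by fun_prop) (by fun_prop) (by fun_prop)
  have hEm : ∀ n a c, Measurable (E n a c) := fun n a c => by
    have := hf1 (n+a); have := hf3 (n+c); have := hf2 (-(n+a+c))
    exact tconv_measurable (by fun_prop) (by fun_prop) (by fun_prop)
  have hEint : ∀ n a c, ∫⁻ τ, E n a c τ = g1 (n + a) * (g3 (n + c) * g2 (-(n + a + c))) := fun n a c =>
    tconv_lintegral ((hf1 _).pow_const 2) ((hf3 _).pow_const 2) ((hf2 _).pow_const 2)
  have hBE : ∀ n a c τ, B n a c τ ^ 2 ≤ ENNReal.ofReal C *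
      rho θ ((τ + 2 * Real.pi * (n:ℝ) ^ 2) - 4 * Real.pi * (a * c : ℤ)) * E n a c τ := by
    intro n a c τ
    refine (tconv_cs (hf1 _) (hf3 _) (hf2 _) (by fun_prop) (by fun_prop) (by fun_prop) τ).trans ?_
    gcongr
    unfold tconv
    simp_rw [rho_sq, show 2 * (1/2 - ε) = 1 - 2 * ε by ring, sub_eq_add_neg _ (2 * Real.pi * _)]
    refine (hconv _ _ _ τ).trans (le_of_eq ?_)
    congr 2
    push_cast; ring
  have hT : ∀ n τ, (∑' k1 : ℤ, ∑' k3 : ℤ, tconv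
      (fun x => j1 k1 * (rho (1/2 - ε) (x + 2 * Real.pi * (k1:ℝ) ^ 2) * f1 k1 x))
      (fun x => j3 k3 * (rho (1/2 - ε) (x + 2 * Real.pi * (k3:ℝ) ^ 2) * f3 k3 x))
      (fun x => j2 (n - k1 - k3) * (rho (1/2 - ε) (x - 2 * Real.pi * ((n - k1 - k3 : ℤ):ℝ) ^ 2) * f2 (n - k1 - k3) x)) τ)
      = ∑' a : ℤ, ∑' c : ℤ, w n a c * B n a c τ := by
    intro n τ
    rw [← (Equiv.addLeft n).tsum_eq]
    refine tsum_congr fun a => ?_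
    rw [← (Equiv.addLeft n).tsum_eq]
    refine tsum_congr fun c => ?_
    simp only [Equiv.coe_addLeft]
    rw [show n - (n + a) - (n + c) = -(n + a + c) by ring]
    have := hf1 (n+a); have := hf3 (n+c); have := hf2 (-(n+a+c))
    rw [tconv_smul _ _ _ (by fun_prop) (by fun_prop) (by fun_prop)]
  simp_rw [hT]
  set NR : ℤ → ℝ → ℝ≥0∞ := fun n τ => ∑' a : ℤ, ∑' c : ℤ, (if a = 0 ∨ c = 0 then 0 else w n a c * B n a c τ) with hNR
  set R1 : ℤ → ℝ → ℝ≥0∞ := fun n τ => ∑' c : ℤ, B n 0 c τ with hR1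
  set R3 : ℤ → ℝ → ℝ≥0∞ := fun n τ => ∑' a : ℤ, B n a 0 τ with hR3
  have hsplit : ∀ n τ, ∑' a : ℤ, ∑' c : ℤ, w n a c * B n a c τ ≤ NR n τ + R1 n τ + R3 n τ := by
    intro n τ
    calc _ ≤ ∑' a : ℤ, ∑' c : ℤ, ((if a = 0 ∨ c = 0 then 0 else w n a c * B n a c τ) +
          (if a = 0 then B n 0 c τ else 0) + (if c = 0 then B n a 0 τ else 0)) := by
          refine ENNReal.tsum_le_tsum fun a => ENNReal.tsum_le_tsum fun c => ?_
          have hx : w n a c * B n a c τ ≤ B n a c τ := by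
            calc _ ≤ 1 * B n a c τ := by gcongr; exact hw1 _ _ _
              _ = _ := one_mul _
          by_cases ha : a = 0
          · subst ha; simp only [true_or, if_true, zero_add]; exact le_add_right hx
          · by_cases hc : c = 0
            · subst hc; simp only [or_true, if_true, zero_add]; exact le_add_left hx
            · simp [ha, hc]
      _ = _ := by
          simp_rw [ENNReal.tsum_add]
          congr 1
          · congr 1
            rw [tsum_eq_single 0]
            · simp [hR1]
            · intro a ha; simp [ha]
          · refine tsum_congr fun a => ?_
            rw [tsum_eq_single 0]
            · simp
            · intro a ha; simp [ha]
  have hNRm : ∀ n, Measurable (NR n) := fun n => by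
    refine Measurable.tsum fun a => Measurable.tsum fun c => ?_
    split_ifs
    · fun_prop
    · exact (hBm n a c).const_mul _
  have hR1m : ∀ n, Measurable (R1 n) := fun n => Measurable.tsum fun c => hBm _ _ _
  have hR3m : ∀ n, Measurable (R3 n) := fun n => Measurable.tsum fun c => hBm _ _ _
  have hBint : ∀ n a c, ∫⁻ τ, B n a c τ ^ 2 ≤ ENNReal.ofReal C * (g1 (n + a) * (g3 (n + c) * g2 (-(n + a + c)))) := by
    intro n a c
    rw [← hEint, ← lintegral_const_mul _ (hEm _ _ _)]
    refine lintegral_mono fun τ => (hBE n a c τ).trans ?_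
    gcongr
    calc _ ≤ ENNReal.ofReal C * 1 := by gcongr; exact rho_le_one _ _ hθ
      _ = _ := mul_one _
  have sh : ∀ (g : ℤ → ℝ≥0∞) (n : ℤ), ∑' a, g (n + a) = ∑' a, g a := fun g n =>
    (Equiv.addLeft n).tsum_eq g
  have shn : ∀ (g : ℤ → ℝ≥0∞) (n : ℤ), ∑' a, g (-(n + a)) = ∑' a, g a := fun g n =>
    ((Equiv.addLeft n).trans (Equiv.neg ℤ)).tsum_eq g
  set G1 := ∑' k, g1 k with hG1
  set G3 := ∑' k, g3 k with hG3
  set G2 := ∑' k, g2 k with hG2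
  have bR1 : ∑' n, ∫⁻ τ, R1 n τ ^ 2 ≤ ENNReal.ofReal C * (G1 * (G3 * G2)) := by
    calc _ ≤ ∑' n, ENNReal.ofReal C * g1 n * (G3 * G2) := by
          refine ENNReal.tsum_le_tsum fun n => ?_
          refine (mink volume _ (fun c => hBm n 0 c) (fun c => ENNReal.ofReal C * g1 n * g3 (n + c))
            (fun c => g2 (-(n + c))) (fun c => ?_)).trans (le_of_eq ?_)
          · refine (hBint n 0 c).trans (le_of_eq ?_)
            simp only [add_zero]; ring
          · rw [ENNReal.tsum_mul_left, sh, shn]; ring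
      _ = _ := by rw [ENNReal.tsum_mul_right, ENNReal.tsum_mul_left]; ring
  have bR3 : ∑' n, ∫⁻ τ, R3 n τ ^ 2 ≤ ENNReal.ofReal C * (G1 * (G3 * G2)) := by
    calc _ ≤ ∑' n, ENNReal.ofReal C * g3 n * (G1 * G2) := by
          refine ENNReal.tsum_le_tsum fun n => ?_
          refine (mink volume _ (fun a => hBm n a 0) (fun a => ENNReal.ofReal C * g3 n * g1 (n + a))
            (fun a => g2 (-(n + a))) (fun a => ?_)).trans (le_of_eq ?_)
          · refine (hBint n a 0).trans (le_of_eq ?_)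
            simp only [add_zero]; ring
          · rw [ENNReal.tsum_mul_left, sh, shn]; ring
      _ = _ := by rw [ENNReal.tsum_mul_right, ENNReal.tsum_mul_left]; ring
  have bNR : ∑' n, ∫⁻ τ, NR n τ ^ 2 ≤ ENNReal.ofReal C * K * (G1 * (G3 * G2)) := by
    have step : ∀ n τ, NR n τ ^ 2 ≤ (ENNReal.ofReal C * K) * ∑' a : ℤ, ∑' c : ℤ, E n a c τ := by
      intro n τ
      have h := cs_tsum (ι := ℤ × ℤ) (fun x => if x.1 = 0 ∨ x.2 = 0 then 0 else w n x.1 x.2 * B n x.1 x.2 τ)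
        (fun x => ENNReal.ofReal C * (if x.1 = 0 ∨ x.2 = 0 then 0 else
          w n x.1 x.2 ^ 2 * rho θ ((τ + 2 * Real.pi * (n:ℝ) ^ 2) - 4 * Real.pi * (x.1 * x.2 : ℤ))))
        (fun x => E n x.1 x.2 τ) ?_
      · rw [ENNReal.tsum_mul_left] at h
        rw [ENNReal.tsum_prod (f := fun a c => if a = 0 ∨ c = 0 then 0 else w n a c * B n a c τ),
          ENNReal.tsum_prod (f := fun a c => E n a c τ),
          ENNReal.tsum_prod (f := fun a c => if a = 0 ∨ c = 0 then 0 else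
          w n a c ^ 2 * rho θ ((τ + 2 * Real.pi * (n:ℝ) ^ 2) - 4 * Real.pi * (a * c : ℤ)))] at h
        refine h.trans ?_
        gcongr
        exact hcount n _
      · intro x
        split_ifs with hx
        · simp
        · rw [mul_pow]
          calc _ ≤ w n x.1 x.2 ^ 2 * (ENNReal.ofReal C * rho θ ((τ + 2*Real.pi*(n:ℝ)^2) - 4*Real.pi*(x.1*x.2:ℤ)) * E n x.1 x.2 τ) := by
                gcongr; exact hBE n x.1 x.2 τ
            _ = _ := by ring
    calc _ ≤ ∑' n, (ENNReal.ofReal C * K) * ∑' a : ℤ, ∑' c : ℤ, g1 (n + a) * (g3 (n + c) * g2 (-(n + a + c))) := by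
          refine ENNReal.tsum_le_tsum fun n => ?_
          refine (lintegral_mono (step n)).trans (le_of_eq ?_)
          rw [lintegral_const_mul _ (Measurable.tsum fun a => Measurable.tsum fun c => hEm _ _ _),
            lintegral_tsum fun a => (Measurable.tsum fun c => hEm _ _ _).aemeasurable]
          congr 1
          refine tsum_congr fun a => ?_
          rw [lintegral_tsum fun c => (hEm _ _ _).aemeasurable]
          exact tsum_congr fun c => hEint n a c
      _ = _ := by
          rw [ENNReal.tsum_mul_left]
          congr 1
          have e1 : ∀ n, ∑' a : ℤ, ∑' c : ℤ, g1 (n + a) * (g3 (n + c) * g2 (-(n + a + c))) =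
              ∑' a : ℤ, ∑' c : ℤ, g1 a * (g3 c * g2 (n - a - c)) := by
            intro n
            rw [← (Equiv.addLeft n).tsum_eq (fun a => ∑' c : ℤ, g1 a * (g3 c * g2 (n - a - c)))]
            refine tsum_congr fun a => ?_
            rw [← (Equiv.addLeft n).tsum_eq (fun c => g1 _ * (g3 c * g2 (n - _ - c)))]
            refine tsum_congr fun c => ?_
            simp only [Equiv.coe_addLeft]
            rw [show n - (n + a) - (n + c) = -(n + a + c) by ring]
          simp_rw [e1]
          rw [ENNReal.tsum_comm, ← ENNReal.tsum_mul_right]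
          refine tsum_congr fun a => ?_
          rw [ENNReal.tsum_comm, ← ENNReal.tsum_mul_right, ← ENNReal.tsum_mul_left]
          refine tsum_congr fun c => ?_
          rw [ENNReal.tsum_mul_left, ENNReal.tsum_mul_left]
          congr 2
          simp_rw [sub_sub]
          exact (Equiv.subRight (a + c)).tsum_eq g2
  calc _ ≤ ∑' n, ∫⁻ τ, 9 * (NR n τ ^ 2 + R1 n τ ^ 2 + R3 n τ ^ 2) := by
        refine ENNReal.tsum_le_tsum fun n => lintegral_mono fun τ => ?_
        refine le_trans ?_ (three_sq _ _ _)
        gcongr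
        exact hsplit n τ
    _ = 9 * ((∑' n, ∫⁻ τ, NR n τ ^ 2) + (∑' n, ∫⁻ τ, R1 n τ ^ 2) + ∑' n, ∫⁻ τ, R3 n τ ^ 2) := by
        rw [← ENNReal.tsum_add, ← ENNReal.tsum_add, ← ENNReal.tsum_mul_left]
        refine tsum_congr fun n => ?_
        have := hNRm n; have := hR1m n; have := hR3m n
        rw [lintegral_const_mul _ (by fun_prop), lintegral_add_left (by fun_prop), lintegral_add_left (by fun_prop)]
    _ ≤ 9 * (ENNReal.ofReal C * K * (G1 * (G3 * G2)) + ENNReal.ofReal C * (G1 * (G3 * G2)) +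
        ENNReal.ofReal C * (G1 * (G3 * G2))) := by gcongr
    _ = _ := by ring


/-- The product of counting measure and Lebesgue measure. -/
noncomputable abbrev mZ : Measure (ℤ × ℝ) := (Measure.count : Measure ℤ).prod (volume : Measure ℝ)

instance count_inv : (Measure.count : Measure ℤ).IsAddLeftInvariant := by infer_instance
instance count_neg : (Measure.count : Measure ℤ).IsNegInvariant := by
  constructor
  ext s hs
  rw [Measure.neg_apply, Measure.count_apply hs, Measure.count_apply hs.neg]
  simp
instance mZ_inv : mZ.IsAddLeftInvariant := by infer_instance
instance mZ_neg : mZ.IsNegInvariant := by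
  constructor
  have h := (Measure.measurePreserving_neg (Measure.count : Measure ℤ)).prod
    (Measure.measurePreserving_neg (volume : Measure ℝ))
  exact h.map_eq

theorem lint_mZ {f : ℤ × ℝ → ℝ≥0∞} (hf : Measurable f) :
    ∫⁻ z, f z ∂mZ = ∑' k : ℤ, ∫⁻ x, f (k, x) := by
  rw [lintegral_prod _ hf.aemeasurable, lintegral_count]

theorem meas_mZ {f : ℤ × ℝ → ℝ≥0∞} (hf : ∀ k, Measurable fun x => f (k, x)) : Measurable f :=
  measurable_from_prod_countable_right hf

theorem conv3_eq {F1 F3 F2 : ℤ × ℝ → ℝ≥0∞} (h1 : Measurable F1) (h3 : Measurable F3) (h2 : Measurable F2)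
    (n : ℤ) (τ : ℝ) : (F1 ⋆ₗ[mZ] (F3 ⋆ₗ[mZ] F2)) (n, τ) =
      ∑' k1 : ℤ, ∑' k3 : ℤ, tconv (fun x => F1 (k1, x)) (fun x => F3 (k3, x)) (fun x => F2 (n - k1 - k3, x)) τ := by
  simp only [lconvolution_def]
  rw [lint_mZ (by fun_prop)]
  refine tsum_congr fun k1 => ?_
  have : ∀ x : ℝ, F1 (k1, x) * ∫⁻ y, F3 y * F2 (-y + (-(k1, x) + (n, τ))) ∂mZ =
      ∑' k3 : ℤ, ∫⁻ y, F1 (k1, x) * (F3 (k3, y) * F2 (n - k1 - k3, τ - x - y)) := by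
    intro x
    rw [lint_mZ (by fun_prop), ← ENNReal.tsum_mul_left]
    refine tsum_congr fun k3 => ?_
    rw [← lintegral_const_mul _ (by fun_prop)]
    refine lintegral_congr fun y => ?_
    congr 3
    ext <;> simp <;> ring
  simp_rw [this]
  rw [lintegral_tsum]
  · rfl
  · intro k3
    exact Measurable.aemeasurable (by fun_prop)

theorem lconv_adj {f g h : ℤ × ℝ → ℝ≥0∞} (hf : Measurable f) (hg : Measurable g) (hh : Measurable h) :
    ∫⁻ z, f z * (g ⋆ₗ[mZ] h) z ∂mZ = ∫⁻ z, (f ⋆ₗ[mZ] (fun z => g (-z))) z * h z ∂mZ := by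
  rw [lconvolution_comm]
  simp only [lconvolution_def]
  have e1 : ∀ z, f z * ∫⁻ y, h y * g (-y + z) ∂mZ = ∫⁻ y, f z * (h y * g (-y + z)) ∂mZ := fun z => by
    rw [lintegral_const_mul _ (by fun_prop)]
  have e2 : ∀ z, (∫⁻ y, f y * g (-(-y + z)) ∂mZ) * h z = ∫⁻ y, f y * g (-(-y + z)) * h z ∂mZ := fun z => by
    rw [lintegral_mul_const _ (by fun_prop)]
  simp_rw [e1, e2]
  rw [lintegral_lintegral_swap (by fun_prop)]
  refine lintegral_congr fun y => lintegral_congr fun z => ?_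
  rw [show -(-z + y) = -y + z by abel]
  ring

theorem lconv_mono {f g f' g' : ℤ × ℝ → ℝ≥0∞} (h : ∀ z, f z ≤ f' z) (h' : ∀ z, g z ≤ g' z) (z : ℤ × ℝ) :
    (f ⋆ₗ[mZ] g) z ≤ (f' ⋆ₗ[mZ] g') z := by
  simp only [lconvolution_def]
  exact lintegral_mono fun y => mul_le_mul' (h _) (h' _)

theorem dual_bound {G : ℤ × ℝ → ℝ≥0∞} (hG : Measurable G) (M : ℝ≥0∞)
    (h : ∀ g : ℤ × ℝ → ℝ≥0∞, Measurable g → (∫⁻ z, g z * G z ∂mZ) ^ 2 ≤ M * ∫⁻ z, g z ^ 2 ∂mZ) :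
    ∫⁻ z, G z ^ 2 ∂mZ ≤ M := by
  set S := spanningSets mZ
  set g : ℕ → ℤ × ℝ → ℝ≥0∞ := fun n => (S n).indicator fun z => min (G z) n with hg
  have hgm : ∀ n, Measurable (g n) := fun n =>
    (hG.min measurable_const).indicator (measurableSet_spanningSets _ _)
  have hgG : ∀ n z, g n z ≤ G z := fun n z => by
    by_cases hz : z ∈ S n <;> simp [hg, hz]
  have hfin : ∀ n, ∫⁻ z, g n z ^ 2 ∂mZ ≠ ∞ := fun n => by
    have : ∀ z, g n z ^ 2 ≤ (S n).indicator (fun _ => (n:ℝ≥0∞) ^ 2) z := by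
      intro z
      by_cases hz : z ∈ S n
      · simp only [hg, hz, Set.indicator_of_mem]; gcongr; exact min_le_right _ _
      · simp [hg, hz]
    refine ((lintegral_mono this).trans_lt ?_).ne
    rw [lintegral_indicator (measurableSet_spanningSets _ _), setLIntegral_const]
    exact ENNReal.mul_lt_top (by simp) (measure_spanningSets_lt_top _ _)
  have hb : ∀ n, ∫⁻ z, g n z ^ 2 ∂mZ ≤ M := by
    intro n
    have h1 := h _ (hgm n)
    have h2 : ∫⁻ z, g n z ^ 2 ∂mZ ≤ ∫⁻ z, g n z * G z ∂mZ := by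
      refine lintegral_mono fun z => ?_
      rw [sq]; gcongr; exact hgG n z
    have h3 : (∫⁻ z, g n z ^ 2 ∂mZ) * (∫⁻ z, g n z ^ 2 ∂mZ) ≤ M * ∫⁻ z, g n z ^ 2 ∂mZ := by
      rw [← sq]; exact le_trans (by gcongr) h1
    by_cases h0 : ∫⁻ z, g n z ^ 2 ∂mZ = 0
    · rw [h0]; exact zero_le
    · exact (ENNReal.mul_le_mul_iff_left h0 (hfin n)).1 h3
  have hmono : Monotone g := by
    intro n m hnm z
    by_cases hz : z ∈ S n
    · have hz' : z ∈ S m := monotone_spanningSets mZ hnm hz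
      simp only [hg, hz, hz', Set.indicator_of_mem]
      exact min_le_min le_rfl (by exact_mod_cast hnm)
    · simp [hg, hz]
  have hsup : ∀ z, G z ^ 2 = ⨆ n, g n z ^ 2 := by
    intro z
    refine le_antisymm ?_ (iSup_le fun n => by gcongr; exact hgG n z)
    have ht : Filter.Tendsto (fun n => g n z) Filter.atTop (nhds (G z)) := by
      have h1 : Filter.Tendsto (fun n : ℕ => min (G z) (n:ℝ≥0∞)) Filter.atTop (nhds (min (G z) ∞)) :=
        tendsto_const_nhds.min ENNReal.tendsto_nat_nhds_top
      rw [min_eq_left le_top] at h1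
      refine h1.congr' ?_
      obtain ⟨N, hN⟩ := Set.mem_iUnion.1 ((iUnion_spanningSets mZ).symm ▸ Set.mem_univ z : z ∈ ⋃ i, S i)
      filter_upwards [Filter.eventually_ge_atTop N] with n hn
      have : z ∈ S n := monotone_spanningSets mZ hn hN
      simp [hg, this]
    have ht2 := (ENNReal.continuous_pow 2).continuousAt.tendsto.comp ht
    exact le_of_tendsto ht2 (Filter.Eventually.of_forall fun n => le_iSup (fun n => g n z ^ 2) n)
  simp_rw [hsup]
  rw [lintegral_iSup (fun n => (hgm n).pow_const 2)]
  · exact iSup_le hb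
  · intro n m hnm z
    have := hmono hnm z
    dsimp only
    gcongr

/-- Measurable functions on the Fourier side. -/
def MF : Type := {f : ℤ × ℝ → ℝ≥0∞ // Measurable f}

noncomputable instance : CommSemigroup MF where
  mul f g := ⟨f.1 ⋆ₗ[mZ] g.1, measurable_lconvolution _ f.2 g.2⟩
  mul_assoc f g h := Subtype.ext (lconvolution_assoc f.2 g.2 h.2).symm
  mul_comm _ _ := Subtype.ext lconvolution_comm

theorem conv_perm {A1 A2 A3 A4 A5 : ℤ × ℝ → ℝ≥0∞} (h1 : Measurable A1) (h2 : Measurable A2)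
    (h3 : Measurable A3) (h4 : Measurable A4) (h5 : Measurable A5) :
    A1 ⋆ₗ[mZ] (A2 ⋆ₗ[mZ] (A3 ⋆ₗ[mZ] (A4 ⋆ₗ[mZ] A5))) = A2 ⋆ₗ[mZ] (A3 ⋆ₗ[mZ] (A5 ⋆ₗ[mZ] (A1 ⋆ₗ[mZ] A4))) ∧
    A1 ⋆ₗ[mZ] (A2 ⋆ₗ[mZ] (A3 ⋆ₗ[mZ] (A4 ⋆ₗ[mZ] A5))) = A4 ⋆ₗ[mZ] (A1 ⋆ₗ[mZ] (A3 ⋆ₗ[mZ] (A5 ⋆ₗ[mZ] A2))) ∧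
    A1 ⋆ₗ[mZ] (A2 ⋆ₗ[mZ] (A3 ⋆ₗ[mZ] (A4 ⋆ₗ[mZ] A5))) = A2 ⋆ₗ[mZ] (A1 ⋆ₗ[mZ] (A5 ⋆ₗ[mZ] (A3 ⋆ₗ[mZ] A4))) ∧
    A1 ⋆ₗ[mZ] (A2 ⋆ₗ[mZ] (A3 ⋆ₗ[mZ] (A4 ⋆ₗ[mZ] A5))) = A2 ⋆ₗ[mZ] (A1 ⋆ₗ[mZ] (A3 ⋆ₗ[mZ] (A5 ⋆ₗ[mZ] A4))) := by
  have key : ∀ a b c d e : MF, a * (b * (c * (d * e))) = b * (c * (e * (a * d))) ∧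
      a * (b * (c * (d * e))) = d * (a * (c * (e * b))) ∧
      a * (b * (c * (d * e))) = b * (a * (e * (c * d))) ∧
      a * (b * (c * (d * e))) = b * (a * (c * (e * d))) := by
    intro a b c d e
    refine ⟨?_, ?_, ?_, ?_⟩ <;> ac_rfl
  obtain ⟨k1, k2, k3, k4⟩ := key ⟨A1, h1⟩ ⟨A2, h2⟩ ⟨A3, h3⟩ ⟨A4, h4⟩ ⟨A5, h5⟩
  exact ⟨congrArg Subtype.val k1, congrArg Subtype.val k2, congrArg Subtype.val k3, congrArg Subtype.val k4⟩


/-- Negative spatial weight. -/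
noncomputable def jj (s : ℝ) (k : ℤ) : ℝ≥0∞ := rho s (2 * Real.pi * (k:ℝ))
/-- Positive spatial weight. -/
noncomputable def JJ (s : ℝ) (k : ℤ) : ℝ≥0∞ := rho (-s) (2 * Real.pi * (k:ℝ))
/-- Modulation weight. -/
noncomputable def pz (ε : ℝ) (z : ℤ × ℝ) : ℝ≥0∞ := rho (1/2 - ε) (z.2 + 2 * Real.pi * (z.1:ℝ) ^ 2)
/-- Conjugate modulation weight. -/
noncomputable def qz (ε : ℝ) (z : ℤ × ℝ) : ℝ≥0∞ := rho (1/2 - ε) (z.2 - 2 * Real.pi * (z.1:ℝ) ^ 2)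
/-- Squared norm. -/
noncomputable def I2 (f : ℤ × ℝ → ℝ≥0∞) : ℝ≥0∞ := ∫⁻ z, f z ^ 2 ∂mZ

theorem jj_meas (s : ℝ) : Measurable (fun z : ℤ × ℝ => jj s z.1) :=
  (measurable_of_countable (jj s)).comp measurable_fst
theorem JJ_meas (s : ℝ) : Measurable (fun z : ℤ × ℝ => JJ s z.1) :=
  (measurable_of_countable (JJ s)).comp measurable_fst
theorem pz_meas (ε : ℝ) : Measurable (pz ε) := by
  have := rho_measurable (1/2 - ε)
  exact meas_mZ fun k => by unfold pz; fun_prop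
theorem qz_meas (ε : ℝ) : Measurable (qz ε) := by
  have := rho_measurable (1/2 - ε)
  exact meas_mZ fun k => by unfold qz; fun_prop

theorem jj_le (s : ℝ) (hs : 0 < s) (k : ℤ) : jj s k ≤ ENNReal.ofReal ((1 + |(k:ℝ)|) ^ (-s)) := by
  unfold jj rho
  refine ENNReal.ofReal_le_ofReal ?_
  refine Real.rpow_le_rpow_of_nonpos (by positivity) ?_ (by linarith)
  have : |(k:ℝ)| ≤ |2 * Real.pi * (k:ℝ)| := by
    rw [abs_mul, abs_of_pos Real.two_pi_pos]
    have := Real.pi_gt_three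
    nlinarith [abs_nonneg (k:ℝ)]
  linarith
theorem jj_neg (s : ℝ) (k : ℤ) : jj s (-k) = jj s k := by
  unfold jj; push_cast; rw [mul_neg, rho_neg]
theorem pz_neg (ε : ℝ) (z : ℤ × ℝ) : pz ε (-z) = qz ε z := by
  unfold pz qz
  rw [← rho_neg]
  congr 1; simp; ring
theorem qz_neg (ε : ℝ) (z : ℤ × ℝ) : qz ε (-z) = pz ε z := by
  unfold pz qz
  rw [← rho_neg]
  congr 1; simp; ring
theorem I2_neg (f : ℤ × ℝ → ℝ≥0∞) : I2 (fun z => f (-z)) = I2 f := by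
  unfold I2
  exact lintegral_neg_eq_self (μ := mZ) (fun z => f z ^ 2)

theorem tri_mZ (θ ε C : ℝ) (hθ : 0 ≤ θ) (K : ℝ≥0∞)
    (hconv : ∀ u v w τ : ℝ,
      ∫⁻ x, ∫⁻ y, rho (1 - 2 * ε) (x + u) * (rho (1 - 2 * ε) (y + v) * rho (1 - 2 * ε) (τ - x - y + w)) ≤
      ENNReal.ofReal C * rho θ (τ + u + v + w))
    (j1 j3 j2 : ℤ → ℝ≥0∞) (hj1 : ∀ k, j1 k ≤ 1) (hj3 : ∀ k, j3 k ≤ 1) (hj2 : ∀ k, j2 k ≤ 1)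
    (hcount : ∀ (n : ℤ) (x : ℝ), ∑' a : ℤ, ∑' c : ℤ, (if a = 0 ∨ c = 0 then 0 else
      (j1 (n + a) * j3 (n + c) * j2 (-(n + a + c))) ^ 2 * rho θ (x - 4 * Real.pi * (a * c : ℤ))) ≤ K)
    {f1 f3 f2 : ℤ × ℝ → ℝ≥0∞} (hf1 : Measurable f1) (hf3 : Measurable f3)
    (hf2 : Measurable f2) :
    I2 ((fun z => j1 z.1 * (pz ε z * f1 z)) ⋆ₗ[mZ] ((fun z => j3 z.1 * (pz ε z * f3 z)) ⋆ₗ[mZ]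
      (fun z => j2 z.1 * (qz ε z * f2 z)))) ≤ 9 * (ENNReal.ofReal C * (K + 2)) * (I2 f1 * (I2 f3 * I2 f2)) := by
  have hp := pz_meas ε
  have hq := qz_meas ε
  have m1 : Measurable (fun z : ℤ × ℝ => j1 z.1 * (pz ε z * f1 z)) :=
    ((measurable_of_countable j1).comp measurable_fst).mul (hp.mul hf1)
  have m3 : Measurable (fun z : ℤ × ℝ => j3 z.1 * (pz ε z * f3 z)) :=
    ((measurable_of_countable j3).comp measurable_fst).mul (hp.mul hf3)
  have m2 : Measurable (fun z : ℤ × ℝ => j2 z.1 * (qz ε z * f2 z)) :=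
    ((measurable_of_countable j2).comp measurable_fst).mul (hq.mul hf2)
  have h := tri_core θ ε C hθ K hconv j1 j3 j2 hj1 hj3 hj2 hcount (fun k x => f1 (k, x))
    (fun k x => f3 (k, x)) (fun k x => f2 (k, x)) (fun k => by fun_prop) (fun k => by fun_prop) (fun k => by fun_prop)
  unfold I2
  rw [lint_mZ (by fun_prop), lint_mZ (by fun_prop), lint_mZ (by fun_prop), lint_mZ (by fun_prop)]
  refine le_trans (le_of_eq ?_) h
  refine tsum_congr fun n => lintegral_congr fun τ => ?_
  rw [conv3_eq m1 m3 m2]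
  rfl

theorem tri_bounds (s : ℝ) (hs : 0 < s) : ∃ ε₀ : ℝ, 0 < ε₀ ∧ ε₀ < 1/2 ∧ ∀ ε : ℝ, 0 < ε → ε < ε₀ →
    ∃ D : ℝ≥0∞, D ≠ ∞ ∧ ∀ f1 f3 f2 : ℤ × ℝ → ℝ≥0∞, Measurable f1 → Measurable f3 → Measurable f2 →
    I2 ((fun z => jj s z.1 * (pz ε z * f1 z)) ⋆ₗ[mZ] ((fun z => pz ε z * f3 z) ⋆ₗ[mZ]
      (fun z => jj s z.1 * (qz ε z * f2 z)))) ≤ D * (I2 f1 * (I2 f3 * I2 f2)) ∧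
    I2 ((fun z => jj s z.1 * (pz ε z * f1 z)) ⋆ₗ[mZ] ((fun z => jj s z.1 * (pz ε z * f3 z)) ⋆ₗ[mZ]
      (fun z => qz ε z * f2 z))) ≤ D * (I2 f1 * (I2 f3 * I2 f2)) := by
  obtain ⟨θ, hθ, hθ1, K, hK, hcount⟩ := count_both s hs
  refine ⟨(1 - θ) / 11, by linarith, by linarith, fun ε hε hε0 => ?_⟩
  obtain ⟨C, hC, hconv⟩ := rho_conv3 θ ε hθ hε (by linarith)
  have hj1 : ∀ k, jj s k ≤ 1 := fun k => rho_le_one _ _ hs.le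
  refine ⟨9 * (ENNReal.ofReal C * (ENNReal.ofReal K + 2)), by finiteness, ?_⟩
  intro f1 f3 f2 h1 h3 h2
  have conv_real : ∀ (a b : ℤ) (y : ℝ), (jj s a * jj s b) ^ 2 * rho θ y ≤
      ENNReal.ofReal (((1 + |((a:ℤ):ℝ)|) ^ (-s) * (1 + |((b:ℤ):ℝ)|) ^ (-s)) ^ 2 * (1 + |y|) ^ (-θ)) := by
    intro a b y
    rw [ENNReal.ofReal_mul (by positivity), ENNReal.ofReal_pow (by positivity), ENNReal.ofReal_mul (by positivity)]
    unfold rho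
    gcongr
    · exact jj_le s hs a
    · exact jj_le s hs b
  constructor
  · have := tri_mZ θ ε C hθ.le (ENNReal.ofReal K) hconv (jj s) (fun _ => 1) (jj s) hj1 (fun _ => le_rfl) hj1 ?_ h1 h3 h2
    · simpa only [one_mul] using this
    · intro n x
      refine le_trans ?_ (hcount n x).2
      refine ENNReal.tsum_le_tsum fun a => ENNReal.tsum_le_tsum fun c => ?_
      split_ifs
      · exact le_rfl
      · rw [mul_one, jj_neg]; exact conv_real _ _ _
  · have := tri_mZ θ ε C hθ.le (ENNReal.ofReal K) hconv (jj s) (jj s) (fun _ => 1) hj1 hj1 (fun _ => le_rfl) ?_ h1 h3 h2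
    · simpa only [one_mul] using this
    · intro n x
      refine le_trans ?_ (hcount n x).1
      refine ENNReal.tsum_le_tsum fun a => ENNReal.tsum_le_tsum fun c => ?_
      split_ifs
      · exact le_rfl
      · rw [mul_one]; exact conv_real _ _ _

/-- Leibniz rule for the spatial weight. -/
theorem JJ_add (s : ℝ) (hs : 0 < s) (a b : ℤ) :
    JJ s (a + b) ≤ ENNReal.ofReal (2 ^ s) * (JJ s a + JJ s b) := by
  unfold JJ rho
  rw [← ENNReal.ofReal_add (by positivity) (by positivity), ← ENNReal.ofReal_mul (by positivity)]
  refine ENNReal.ofReal_le_ofReal ?_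
  simp only [neg_neg]
  set A := 1 + |2 * Real.pi * (a:ℝ)|
  set B := 1 + |2 * Real.pi * (b:ℝ)|
  have hA : 0 < A := by positivity
  have hB : 0 < B := by positivity
  have h0 : 1 + |2 * Real.pi * ((a + b : ℤ):ℝ)| ≤ 2 * max A B := by
    have : |2 * Real.pi * ((a + b : ℤ):ℝ)| ≤ |2 * Real.pi * (a:ℝ)| + |2 * Real.pi * (b:ℝ)| := by
      push_cast; rw [mul_add]; exact abs_add_le _ _
    have h1 := le_max_left A B
    have h2 := le_max_right A B
    simp only [A, B] at *
    linarith
  calc (1 + |2 * Real.pi * ((a + b : ℤ):ℝ)|) ^ s ≤ (2 * max A B) ^ s := by gcongr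
    _ = 2 ^ s * (max A B) ^ s := Real.mul_rpow (by norm_num) (by positivity)
    _ ≤ 2 ^ s * (A ^ s + B ^ s) := by
        gcongr
        rcases le_total A B with h | h
        · rw [max_eq_right h]; have : 0 ≤ A ^ s := by positivity
          linarith
        · rw [max_eq_left h]; have : 0 ≤ B ^ s := by positivity
          linarith

theorem lconv_leib (s : ℝ) (hs : 0 < s) {f g : ℤ × ℝ → ℝ≥0∞} (hf : Measurable f) (hg : Measurable g) (z : ℤ × ℝ) :
    JJ s z.1 * (f ⋆ₗ[mZ] g) z ≤ ENNReal.ofReal (2 ^ s) *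
      (((fun z => JJ s z.1 * f z) ⋆ₗ[mZ] g) z + (f ⋆ₗ[mZ] (fun z => JJ s z.1 * g z)) z) := by
  have hJ := JJ_meas s
  simp only [lconvolution_def]
  rw [← lintegral_add_left (by fun_prop), ← lintegral_const_mul _ (by fun_prop), ← lintegral_const_mul _ (by fun_prop)]
  refine lintegral_mono fun y => ?_
  have h := JJ_add s hs y.1 (-y + z).1
  rw [show y.1 + (-y + z).1 = z.1 by simp] at h
  calc _ ≤ (ENNReal.ofReal (2 ^ s) * (JJ s y.1 + JJ s (-y + z).1)) * (f y * g (-y + z)) := by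
        gcongr
    _ = _ := by ring

theorem lconv_leib5 (s : ℝ) (hs : 0 < s) {A1 A2 A3 A4 A5 : ℤ × ℝ → ℝ≥0∞} (h1 : Measurable A1) (h2 : Measurable A2)
    (h3 : Measurable A3) (h4 : Measurable A4) (h5 : Measurable A5) (z : ℤ × ℝ) :
    JJ s z.1 * (A1 ⋆ₗ[mZ] (A2 ⋆ₗ[mZ] (A3 ⋆ₗ[mZ] (A4 ⋆ₗ[mZ] A5)))) z ≤ ENNReal.ofReal (2 ^ s) ^ 4 *
    (((fun z => JJ s z.1 * A1 z) ⋆ₗ[mZ] (A2 ⋆ₗ[mZ] (A3 ⋆ₗ[mZ] (A4 ⋆ₗ[mZ] A5)))) z +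
     ((A1 ⋆ₗ[mZ] ((fun z => JJ s z.1 * A2 z) ⋆ₗ[mZ] (A3 ⋆ₗ[mZ] (A4 ⋆ₗ[mZ] A5)))) z +
     ((A1 ⋆ₗ[mZ] (A2 ⋆ₗ[mZ] ((fun z => JJ s z.1 * A3 z) ⋆ₗ[mZ] (A4 ⋆ₗ[mZ] A5)))) z +
     ((A1 ⋆ₗ[mZ] (A2 ⋆ₗ[mZ] (A3 ⋆ₗ[mZ] ((fun z => JJ s z.1 * A4 z) ⋆ₗ[mZ] A5)))) z +
     (A1 ⋆ₗ[mZ] (A2 ⋆ₗ[mZ] (A3 ⋆ₗ[mZ] (A4 ⋆ₗ[mZ] (fun z => JJ s z.1 * A5 z))))) z)))) := by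
  have hJ := JJ_meas s
  set c := ENNReal.ofReal (2 ^ s) with hc
  have hc1 : 1 ≤ c := by
    rw [hc, ENNReal.one_le_ofReal]; exact Real.one_le_rpow (by norm_num) hs.le
  have lin : ∀ {a f g : ℤ × ℝ → ℝ≥0∞} (d : ℝ≥0∞), Measurable a → Measurable f → Measurable g → ∀ z,
      (a ⋆ₗ[mZ] (fun z => d * (f z + g z))) z = d * ((a ⋆ₗ[mZ] f) z + (a ⋆ₗ[mZ] g) z) := by
    intro a f g d ha hf hg z
    simp only [lconvolution_def]
    rw [← lintegral_add_left (by fun_prop), ← lintegral_const_mul _ (by fun_prop)]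
    refine lintegral_congr fun y => ?_
    ring
  -- induction step
  have step : ∀ {a b u v : ℤ × ℝ → ℝ≥0∞} (d : ℝ≥0∞), 1 ≤ d → Measurable a → Measurable b → Measurable u → Measurable v →
      (∀ z, JJ s z.1 * b z ≤ d * (u z + v z)) → ∀ z,
      JJ s z.1 * (a ⋆ₗ[mZ] b) z ≤ (c * d) * (((fun z => JJ s z.1 * a z) ⋆ₗ[mZ] b) z +
        ((a ⋆ₗ[mZ] u) z + (a ⋆ₗ[mZ] v) z)) := by
    intro a b u v d hd ha hb hu hv h z
    refine (lconv_leib s hs ha hb z).trans ?_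
    have h' : (a ⋆ₗ[mZ] (fun z => JJ s z.1 * b z)) z ≤ d * ((a ⋆ₗ[mZ] u) z + (a ⋆ₗ[mZ] v) z) := by
      rw [← lin d ha hu hv]
      exact lconv_mono (fun _ => le_rfl) h z
    calc _ ≤ c * (d * ((fun z => JJ s z.1 * a z) ⋆ₗ[mZ] b) z + d * ((a ⋆ₗ[mZ] u) z + (a ⋆ₗ[mZ] v) z)) := by
          gcongr
          exact le_mul_of_one_le_left zero_le hd
      _ = _ := by ring
  have lin2 : ∀ {a f g : ℤ × ℝ → ℝ≥0∞}, Measurable a → Measurable f → Measurable g → ∀ z,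
      (a ⋆ₗ[mZ] (fun z => f z + g z)) z = (a ⋆ₗ[mZ] f) z + (a ⋆ₗ[mZ] g) z := by
    intro a f g ha hf hg z
    have := lin 1 ha hf hg z
    simpa using this
  have s1 := fun z => lconv_leib s hs h4 h5 z
  have s2 := step c hc1 h3 (by fun_prop) (by fun_prop) (by fun_prop) s1
  have s3 := step (c * c) (one_le_mul hc1 hc1) h2 (by fun_prop) (by fun_prop) (by fun_prop) s2
  have s4 := step (c * (c * c)) (one_le_mul hc1 (one_le_mul hc1 hc1)) h1 (by fun_prop) (by fun_prop) (by fun_prop) s3 z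
  refine s4.trans (le_of_eq ?_)
  have e1 : (A2 ⋆ₗ[mZ] (fun z => (A3 ⋆ₗ[mZ] ((fun z => JJ s z.1 * A4 z) ⋆ₗ[mZ] A5)) z + (A3 ⋆ₗ[mZ] (A4 ⋆ₗ[mZ] (fun z => JJ s z.1 * A5 z))) z)) = _ :=
    funext fun z => lin2 h2 (by fun_prop) (by fun_prop) z
  rw [lin2 h1 (by fun_prop) (by fun_prop)]
  rw [e1, lin2 h1 (by fun_prop) (by fun_prop)]
  ring


theorem six_form {f X Y W : ℤ × ℝ → ℝ≥0∞} (hf : Measurable f) (hX : Measurable X) (hY : Measurable Y)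
    (hW : Measurable W) :
    (∫⁻ z, f z * (X ⋆ₗ[mZ] (Y ⋆ₗ[mZ] W)) z ∂mZ) ^ 2 ≤
      I2 ((fun z => X (-z)) ⋆ₗ[mZ] (f ⋆ₗ[mZ] (fun z => Y (-z)))) * I2 W := by
  have hX' : Measurable (fun z => X (-z)) := by fun_prop
  have hY' : Measurable (fun z => Y (-z)) := by fun_prop
  rw [lconv_adj hf hX (by fun_prop), lconv_adj (by fun_prop) hY hW,
    lconvolution_comm (f := f) (g := fun z => X (-z)), ← lconvolution_assoc hX' hf hY']
  exact cs' mZ _ _ _ (by fun_prop) (by fun_prop) (fun z => by rw [mul_pow])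

/-- Weighted factor. -/
noncomputable def PA (s ε : ℝ) (F : ℤ × ℝ → ℝ≥0∞) : ℤ × ℝ → ℝ≥0∞ := fun z => jj s z.1 * (pz ε z * F z)
/-- Weighted conjugate factor. -/
noncomputable def QA (s ε : ℝ) (F : ℤ × ℝ → ℝ≥0∞) : ℤ × ℝ → ℝ≥0∞ := fun z => jj s z.1 * (qz ε z * F z)

theorem PA_meas (s ε : ℝ) {F : ℤ × ℝ → ℝ≥0∞} (h : Measurable F) : Measurable (PA s ε F) :=
  (jj_meas s).mul ((pz_meas ε).mul h)
theorem QA_meas (s ε : ℝ) {F : ℤ × ℝ → ℝ≥0∞} (h : Measurable F) : Measurable (QA s ε F) :=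
  (jj_meas s).mul ((qz_meas ε).mul h)
theorem PA_neg (s ε : ℝ) (F : ℤ × ℝ → ℝ≥0∞) : (fun z => PA s ε F (-z)) = QA s ε (fun z => F (-z)) := by
  funext z; unfold PA QA; rw [pz_neg, Prod.fst_neg, jj_neg]
theorem QA_neg (s ε : ℝ) (F : ℤ × ℝ → ℝ≥0∞) : (fun z => QA s ε F (-z)) = PA s ε (fun z => F (-z)) := by
  funext z; unfold PA QA; rw [qz_neg, Prod.fst_neg, jj_neg]
theorem JJ_jj (s : ℝ) (k : ℤ) : JJ s k * jj s k = 1 := by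
  unfold JJ jj rho
  rw [← ENNReal.ofReal_mul (by positivity), ← Real.rpow_add (by positivity)]
  simp
theorem JJ_PA (s ε : ℝ) (F : ℤ × ℝ → ℝ≥0∞) : (fun z => JJ s z.1 * PA s ε F z) = fun z => pz ε z * F z := by
  funext z; unfold PA; rw [← mul_assoc, JJ_jj, one_mul]
theorem JJ_QA (s ε : ℝ) (F : ℤ × ℝ → ℝ≥0∞) : (fun z => JJ s z.1 * QA s ε F z) = fun z => qz ε z * F z := by
  funext z; unfold QA; rw [← mul_assoc, JJ_jj, one_mul]

theorem quint_conv (s : ℝ) (hs : 0 < s) : ∃ ε₀ : ℝ, 0 < ε₀ ∧ ε₀ < 1/2 ∧ ∀ ε : ℝ, 0 < ε → ε < ε₀ →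
    ∃ D : ℝ≥0∞, D ≠ ∞ ∧ ∀ F1 F2 F3 F4 F5 : ℤ × ℝ → ℝ≥0∞, Measurable F1 → Measurable F2 → Measurable F3 →
    Measurable F4 → Measurable F5 →
    I2 (fun z => pz ε z * (JJ s z.1 * (PA s ε F1 ⋆ₗ[mZ] (QA s ε F2 ⋆ₗ[mZ] (PA s ε F3 ⋆ₗ[mZ] (QA s ε F4 ⋆ₗ[mZ] PA s ε F5)))) z))
      ≤ D * (I2 F1 * I2 F2 * I2 F3 * I2 F4 * I2 F5) := by
  obtain ⟨ε₀, h0, h1, H⟩ := tri_bounds s hs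
  refine ⟨ε₀, h0, h1, fun ε hε hε0 => ?_⟩
  obtain ⟨D, hD, T⟩ := H ε hε hε0
  refine ⟨(ENNReal.ofReal (2 ^ s) ^ 4 * 5) ^ 2 * D ^ 2, by finiteness, ?_⟩
  intro F1 F2 F3 F4 F5 m1 m2 m3 m4 m5
  have a1 := PA_meas s ε m1
  have a2 := QA_meas s ε m2
  have a3 := PA_meas s ε m3
  have a4 := QA_meas s ε m4
  have a5 := PA_meas s ε m5
  have hp := pz_meas ε
  have hq := qz_meas ε
  have hJ := JJ_meas s
  refine dual_bound (by fun_prop) _ fun g hg => ?_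
  -- the two basic six-linear bounds
  have L1 : ∀ {f P P' Pt Q Q' : ℤ × ℝ → ℝ≥0∞}, Measurable f → Measurable P → Measurable P' → Measurable Pt →
      Measurable Q → Measurable Q' →
      (∫⁻ z, (pz ε z * f z) * (QA s ε Q ⋆ₗ[mZ] (PA s ε P ⋆ₗ[mZ] (PA s ε P' ⋆ₗ[mZ] ((fun z => pz ε z * Pt z) ⋆ₗ[mZ] QA s ε Q')))) z ∂mZ) ^ 2 ≤
      D ^ 2 * (I2 Q * I2 P * I2 P' * I2 Pt * I2 Q') * I2 f := by
    intro f P P' Pt Q Q' hf hP hP' hPt hQ hQ'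
    refine (six_form (f := fun z => pz ε z * f z) (by fun_prop) (QA_meas s ε hQ) (PA_meas s ε hP)
      (measurable_lconvolution _ (PA_meas s ε hP') (measurable_lconvolution _ (by fun_prop) (QA_meas s ε hQ')))).trans ?_
    rw [PA_neg, QA_neg]
    have b1 := (T (fun z => Q (-z)) f (fun z => P (-z)) (by fun_prop) hf (by fun_prop)).1
    have b2 := (T P' Pt Q' hP' hPt hQ').1
    rw [I2_neg, I2_neg] at b1
    refine (mul_le_mul' b1 b2).trans (le_of_eq ?_)
    ring
  have L2 : ∀ {f P P' P'' Q Qt : ℤ × ℝ → ℝ≥0∞}, Measurable f → Measurable P → Measurable P' → Measurable P'' →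
      Measurable Q → Measurable Qt →
      (∫⁻ z, (pz ε z * f z) * (QA s ε Q ⋆ₗ[mZ] (PA s ε P ⋆ₗ[mZ] (PA s ε P' ⋆ₗ[mZ] (PA s ε P'' ⋆ₗ[mZ] (fun z => qz ε z * Qt z))))) z ∂mZ) ^ 2 ≤
      D ^ 2 * (I2 Q * I2 P * I2 P' * I2 P'' * I2 Qt) * I2 f := by
    intro f P P' P'' Q Qt hf hP hP' hP'' hQ hQt
    refine (six_form (f := fun z => pz ε z * f z) (by fun_prop) (QA_meas s ε hQ) (PA_meas s ε hP)
      (measurable_lconvolution _ (PA_meas s ε hP') (measurable_lconvolution _ (PA_meas s ε hP'') (by fun_prop)))).trans ?_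
    rw [PA_neg, QA_neg]
    have b1 := (T (fun z => Q (-z)) f (fun z => P (-z)) (by fun_prop) hf (by fun_prop)).1
    have b2 := (T P' P'' Qt hP' hP'' hQt).2
    rw [I2_neg, I2_neg] at b1
    refine (mul_le_mul' b1 b2).trans (le_of_eq ?_)
    ring
  set B := D ^ 2 * (I2 F1 * I2 F2 * I2 F3 * I2 F4 * I2 F5) * I2 g with hB
  have hP : ∀ {F : ℤ × ℝ → ℝ≥0∞}, Measurable F → Measurable (fun z => pz ε z * F z) := fun h => hp.mul h
  have hQ : ∀ {F : ℤ × ℝ → ℝ≥0∞}, Measurable F → Measurable (fun z => qz ε z * F z) := fun h => hq.mul h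
  have t1 : (∫⁻ z, (pz ε z * g z) * ((fun z => pz ε z * F1 z) ⋆ₗ[mZ] (QA s ε F2 ⋆ₗ[mZ] (PA s ε F3 ⋆ₗ[mZ] (QA s ε F4 ⋆ₗ[mZ] PA s ε F5)))) z ∂mZ) ^ 2 ≤ B := by
    rw [(conv_perm (hP m1) a2 a3 a4 a5).1]
    exact (L1 hg m3 m5 m1 m2 m4).trans (le_of_eq (by rw [hB]; ring))
  have t2 : (∫⁻ z, (pz ε z * g z) * (PA s ε F1 ⋆ₗ[mZ] ((fun z => qz ε z * F2 z) ⋆ₗ[mZ] (PA s ε F3 ⋆ₗ[mZ] (QA s ε F4 ⋆ₗ[mZ] PA s ε F5)))) z ∂mZ) ^ 2 ≤ B := by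
    rw [(conv_perm a1 (hQ m2) a3 a4 a5).2.1]
    exact (L2 hg m1 m3 m5 m4 m2).trans (le_of_eq (by rw [hB]; ring))
  have t3 : (∫⁻ z, (pz ε z * g z) * (PA s ε F1 ⋆ₗ[mZ] (QA s ε F2 ⋆ₗ[mZ] ((fun z => pz ε z * F3 z) ⋆ₗ[mZ] (QA s ε F4 ⋆ₗ[mZ] PA s ε F5)))) z ∂mZ) ^ 2 ≤ B := by
    rw [(conv_perm a1 a2 (hP m3) a4 a5).2.2.1]
    exact (L1 hg m1 m5 m3 m2 m4).trans (le_of_eq (by rw [hB]; ring))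
  have t4 : (∫⁻ z, (pz ε z * g z) * (PA s ε F1 ⋆ₗ[mZ] (QA s ε F2 ⋆ₗ[mZ] (PA s ε F3 ⋆ₗ[mZ] ((fun z => qz ε z * F4 z) ⋆ₗ[mZ] PA s ε F5)))) z ∂mZ) ^ 2 ≤ B := by
    rw [(conv_perm a1 a2 a3 (hQ m4) a5).2.2.2]
    exact (L2 hg m1 m3 m5 m2 m4).trans (le_of_eq (by rw [hB]; ring))
  have t5 : (∫⁻ z, (pz ε z * g z) * (PA s ε F1 ⋆ₗ[mZ] (QA s ε F2 ⋆ₗ[mZ] (PA s ε F3 ⋆ₗ[mZ] (QA s ε F4 ⋆ₗ[mZ] (fun z => pz ε z * F5 z))))) z ∂mZ) ^ 2 ≤ B := by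
    rw [(conv_perm a1 a2 a3 a4 (hP m5)).2.2.2]
    exact (L1 hg m1 m3 m5 m2 m4).trans (le_of_eq (by rw [hB]; ring))
  have sq : ∀ {x : ℝ≥0∞}, x ^ 2 ≤ B → x ≤ B ^ (1/2:ℝ) := by
    intro x hx
    rw [← sq_le_iff]
    refine hx.trans (le_of_eq ?_)
    rw [← ENNReal.rpow_natCast, ← ENNReal.rpow_mul]; norm_num
  have main : ∫⁻ z, g z * (pz ε z * (JJ s z.1 * (PA s ε F1 ⋆ₗ[mZ] (QA s ε F2 ⋆ₗ[mZ] (PA s ε F3 ⋆ₗ[mZ] (QA s ε F4 ⋆ₗ[mZ] PA s ε F5)))) z)) ∂mZ ≤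
      ENNReal.ofReal (2 ^ s) ^ 4 * (B ^ (1/2:ℝ) + (B ^ (1/2:ℝ) + (B ^ (1/2:ℝ) + (B ^ (1/2:ℝ) + B ^ (1/2:ℝ))))) := by
    have lb := lconv_leib5 s hs a1 a2 a3 a4 a5
    simp only [JJ_PA, JJ_QA] at lb
    refine le_trans ?_ (mul_le_mul_right (add_le_add (sq t1) (add_le_add (sq t2) (add_le_add (sq t3) (add_le_add (sq t4) (sq t5))))) _)
    have n1 := hP m1
    have n2 := hQ m2
    have n3 := hP m3
    have n4 := hQ m4
    have n5 := hP m5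
    rw [← lintegral_add_right _ (by fun_prop), ← lintegral_add_right _ (by fun_prop), ← lintegral_add_right _ (by fun_prop),
      ← lintegral_add_right _ (by fun_prop), ← lintegral_const_mul _ (by fun_prop)]
    refine lintegral_mono fun z => ?_
    calc _ = (pz ε z * g z) * (JJ s z.1 * (PA s ε F1 ⋆ₗ[mZ] (QA s ε F2 ⋆ₗ[mZ] (PA s ε F3 ⋆ₗ[mZ] (QA s ε F4 ⋆ₗ[mZ] PA s ε F5)))) z) := by ring
      _ ≤ (pz ε z * g z) * _ := mul_le_mul_right (lb z) _
      _ = _ := by ring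
  calc _ ≤ (ENNReal.ofReal (2 ^ s) ^ 4 * (B ^ (1/2:ℝ) + (B ^ (1/2:ℝ) + (B ^ (1/2:ℝ) + (B ^ (1/2:ℝ) + B ^ (1/2:ℝ)))))) ^ 2 := by
        gcongr
    _ = (ENNReal.ofReal (2 ^ s) ^ 4 * 5) ^ 2 * (B ^ (1/2:ℝ)) ^ 2 := by ring
    _ = (ENNReal.ofReal (2 ^ s) ^ 4 * 5) ^ 2 * B := by
        rw [← ENNReal.rpow_natCast (B ^ (1/2:ℝ)), ← ENNReal.rpow_mul]; norm_num
    _ = _ := by rw [hB]; unfold I2; ring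


/-- Smooth functions on the circle times the line, with compact time support. -/
structure Sm (v : AddCircle (1:ℝ) → ℝ → ℂ) : Prop where
  smooth : ContDiff ℝ (⊤ : ℕ∞) (fun p : ℝ × ℝ => v ((p.1 : ℝ) : AddCircle (1:ℝ)) p.2)
  supp : ∃ R : ℝ, ∀ (x : AddCircle (1:ℝ)) (t : ℝ), R ≤ |t| → v x t = 0

/-- Space derivative. -/
noncomputable def dxv (v : AddCircle (1:ℝ) → ℝ → ℂ) (x : AddCircle (1:ℝ)) (t : ℝ) : ℂ :=
  deriv (fun h : ℝ => v (x + (h : AddCircle (1:ℝ))) t) 0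
/-- Time derivative. -/
noncomputable def dtv (v : AddCircle (1:ℝ) → ℝ → ℂ) (x : AddCircle (1:ℝ)) (t : ℝ) : ℂ :=
  deriv (fun h : ℝ => v x h) t

theorem Sm.cont {v : AddCircle (1:ℝ) → ℝ → ℂ} (h : Sm v) :
    Continuous (fun p : ℝ × AddCircle (1:ℝ) => v p.2 p.1) := by
  have hq : IsOpenQuotientMap (fun x : ℝ => (x : AddCircle (1:ℝ))) := QuotientAddGroup.isOpenQuotientMap_mk
  have hq2 := hq.prodMap (IsOpenQuotientMap.id (X := ℝ))
  have h1 : Continuous (fun p : AddCircle (1:ℝ) × ℝ => v p.1 p.2) := by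
    rw [← hq2.continuous_comp_iff]
    exact h.smooth.continuous
  exact h1.comp continuous_swap

theorem Sm.hcs {v : AddCircle (1:ℝ) → ℝ → ℂ} (h : Sm v) :
    HasCompactSupport (fun p : ℝ × AddCircle (1:ℝ) => v p.2 p.1) := by
  obtain ⟨R, hR⟩ := h.supp
  refine HasCompactSupport.intro (K := Metric.closedBall 0 R ×ˢ Set.univ)
    ((isCompact_closedBall _ _).prod isCompact_univ) ?_
  intro p hp
  refine hR _ _ ?_
  by_contra hc
  apply hp
  simp only [Set.mem_prod, Set.mem_univ, and_true, Metric.mem_closedBall, dist_zero_right, Real.norm_eq_abs]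
  linarith

theorem Sm.hcs_t {v : AddCircle (1:ℝ) → ℝ → ℂ} (h : Sm v) (x : AddCircle (1:ℝ)) :
    HasCompactSupport (fun t => v x t) := by
  obtain ⟨R, hR⟩ := h.supp
  refine HasCompactSupport.intro (K := Metric.closedBall 0 R) (isCompact_closedBall _ _) ?_
  intro p hp
  refine hR _ _ ?_
  by_contra hc
  apply hp
  simp only [Metric.mem_closedBall, dist_zero_right, Real.norm_eq_abs]
  linarith

theorem Sm.hasDerivAt_x {v : AddCircle (1:ℝ) → ℝ → ℂ} (h : Sm v) (a t : ℝ) :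
    HasDerivAt (fun y : ℝ => v (y : AddCircle (1:ℝ)) t)
      (fderiv ℝ (fun p : ℝ × ℝ => v ((p.1 : ℝ) : AddCircle (1:ℝ)) p.2) (a, t) (1, 0)) a := by
  have h1 := (h.smooth.differentiable (by simp)).differentiableAt (x := (a, t)) |>.hasFDerivAt
  have h2 : HasDerivAt (fun y : ℝ => (y, t)) ((1:ℝ), (0:ℝ)) a := (hasDerivAt_id a).prodMk (hasDerivAt_const a t)
  exact h1.comp_hasDerivAt a h2

theorem Sm.hasDerivAt_t {v : AddCircle (1:ℝ) → ℝ → ℂ} (h : Sm v) (a t : ℝ) :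
    HasDerivAt (fun y : ℝ => v (a : AddCircle (1:ℝ)) y)
      (fderiv ℝ (fun p : ℝ × ℝ => v ((p.1 : ℝ) : AddCircle (1:ℝ)) p.2) (a, t) (0, 1)) t := by
  have h1 := (h.smooth.differentiable (by simp)).differentiableAt (x := (a, t)) |>.hasFDerivAt
  have h2 : HasDerivAt (fun y : ℝ => (a, y)) ((0:ℝ), (1:ℝ)) t := (hasDerivAt_const t a).prodMk (hasDerivAt_id t)
  exact h1.comp_hasDerivAt t h2

theorem Sm.dxv_eq {v : AddCircle (1:ℝ) → ℝ → ℂ} (h : Sm v) (a t : ℝ) :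
    dxv v (a : AddCircle (1:ℝ)) t =
      fderiv ℝ (fun p : ℝ × ℝ => v ((p.1 : ℝ) : AddCircle (1:ℝ)) p.2) (a, t) (1, 0) := by
  unfold dxv
  have h1 := h.hasDerivAt_x (a + 0) t
  have h2 := HasDerivAt.comp_const_add a 0 h1
  simp only [add_zero] at h2
  have : (fun h : ℝ => v ((a : AddCircle (1:ℝ)) + (h : AddCircle (1:ℝ))) t) =
      fun x : ℝ => v ((a + x : ℝ) : AddCircle (1:ℝ)) t := by
    funext h; rw [AddCircle.coe_add]
  rw [this]
  exact h2.deriv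

theorem Sm.dtv_eq {v : AddCircle (1:ℝ) → ℝ → ℂ} (h : Sm v) (a t : ℝ) :
    dtv v (a : AddCircle (1:ℝ)) t =
      fderiv ℝ (fun p : ℝ × ℝ => v ((p.1 : ℝ) : AddCircle (1:ℝ)) p.2) (a, t) (0, 1) :=
  (h.hasDerivAt_t a t).deriv

theorem Sm.dx {v : AddCircle (1:ℝ) → ℝ → ℂ} (h : Sm v) : Sm (dxv v) where
  smooth := by
    have : (fun p : ℝ × ℝ => dxv v ((p.1 : ℝ) : AddCircle (1:ℝ)) p.2) = fun p =>
      fderiv ℝ (fun p : ℝ × ℝ => v ((p.1 : ℝ) : AddCircle (1:ℝ)) p.2) p (1, 0) := by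
      funext p; exact h.dxv_eq p.1 p.2
    rw [this]
    exact (h.smooth.fderiv_right (m := (⊤ : ℕ∞)) (by simp)).clm_apply contDiff_const
  supp := by
    obtain ⟨R, hR⟩ := h.supp
    refine ⟨R, fun x t ht => ?_⟩
    unfold dxv
    simp [hR _ t ht]

theorem Sm.dt {v : AddCircle (1:ℝ) → ℝ → ℂ} (h : Sm v) : Sm (dtv v) where
  smooth := by
    have : (fun p : ℝ × ℝ => dtv v ((p.1 : ℝ) : AddCircle (1:ℝ)) p.2) = fun p =>
      fderiv ℝ (fun p : ℝ × ℝ => v ((p.1 : ℝ) : AddCircle (1:ℝ)) p.2) p (0, 1) := by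
      funext p; exact h.dtv_eq p.1 p.2
    rw [this]
    exact (h.smooth.fderiv_right (m := (⊤ : ℕ∞)) (by simp)).clm_apply contDiff_const
  supp := by
    obtain ⟨R, hR⟩ := h.supp
    refine ⟨R + 1, fun x t ht => ?_⟩
    unfold dtv
    have : (fun h => v x h) =ᶠ[nhds t] fun _ => 0 := by
      have : ∀ᶠ y in nhds t, R < |y| := (continuous_abs.tendsto t).eventually_const_lt (by linarith)
      filter_upwards [this] with y hy
      exact hR x y hy.le
    rw [this.deriv_eq]
    simp

/-- Characters. -/
noncomputable def Ech (z : ℤ × ℝ) (y : ℝ × AddCircle (1:ℝ)) : ℂ :=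
  fourier z.1 y.2 * Complex.exp ((2 * Real.pi * z.2 * y.1 : ℝ) * Complex.I)

theorem Ech_norm (z y) : ‖Ech z y‖ = 1 := by
  unfold Ech
  rw [norm_mul, Complex.norm_exp_ofReal_mul_I, mul_one]
  exact Circle.norm_coe _

theorem Ech_add (z z' y) : Ech (z + z') y = Ech z y * Ech z' y := by
  unfold Ech
  simp only [Prod.fst_add, Prod.snd_add]
  rw [fourier_add, show (2 * Real.pi * (z.2 + z'.2) * y.1 : ℝ) = 2 * Real.pi * z.2 * y.1 + 2 * Real.pi * z'.2 * y.1 by ring,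
    Complex.ofReal_add, add_mul, Complex.exp_add]
  ring

theorem Ech_neg (z y) : Ech (-z) y = (starRingEnd ℂ) (Ech z y) := by
  unfold Ech
  simp only [Prod.fst_neg, Prod.snd_neg]
  rw [map_mul, fourier_neg, ← Complex.exp_conj]
  congr 2
  rw [map_mul, Complex.conj_ofReal, Complex.conj_I]
  push_cast
  ring

theorem Ech_neg' (k : ℤ) (η : ℝ) (y : ℝ × AddCircle (1:ℝ)) :
    Ech (-(k, η)) y = fourier (-k) y.2 * Complex.exp (-(2 * Real.pi * η * y.1) * Complex.I) := by
  unfold Ech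
  simp

theorem Ech_cont (k : ℤ) : Continuous (fun p : ℝ × (ℝ × AddCircle (1:ℝ)) => Ech (k, p.1) p.2) := by
  unfold Ech
  have := (fourier (T := (1:ℝ)) k).continuous
  fun_prop

theorem fourier_meas : Measurable (fun q : ℤ × AddCircle (1:ℝ) => (fourier q.1 q.2 : ℂ)) := by
  refine measurable_from_prod_countable_right fun k => ?_
  exact (fourier (T := (1:ℝ)) k).continuous.measurable

theorem Ech_meas : Measurable (fun p : (ℤ × ℝ) × (ℝ × AddCircle (1:ℝ)) => Ech p.1 p.2) := by
  have h2 : Measurable (fun p : (ℤ × ℝ) × (ℝ × AddCircle (1:ℝ)) => (p.1.1, p.2.2)) := by fun_prop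
  have h3 : Measurable (fun p : (ℤ × ℝ) × (ℝ × AddCircle (1:ℝ)) =>
    Complex.exp ((2 * Real.pi * p.1.2 * p.2.1 : ℝ) * Complex.I)) := by fun_prop
  exact (fourier_meas.comp h2).mul h3

theorem sFT_eq {v : AddCircle (1:ℝ) → ℝ → ℂ} (k : ℤ) (η : ℝ)
    (hi : Integrable (fun y : ℝ × AddCircle (1:ℝ) => v y.2 y.1)) : spacetimeFT v k η =
    ∫ y : ℝ × AddCircle (1:ℝ), v y.2 y.1 * Ech (-(k, η)) y := by
  rw [Measure.volume_eq_prod, integral_prod]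
  · unfold spacetimeFT
    simp_rw [Ech_neg', mul_assoc]
  · rw [← Measure.volume_eq_prod]
    refine hi.mul_bdd (c := 1) ?_ (Filter.Eventually.of_forall fun y => (Ech_norm _ _).le)
    exact (Ech_meas.comp (measurable_const.prodMk measurable_id)).aestronglyMeasurable

theorem Sm.integrable {v : AddCircle (1:ℝ) → ℝ → ℂ} (h : Sm v) :
    Integrable (fun y : ℝ × AddCircle (1:ℝ) => v y.2 y.1) := by
  rw [Measure.volume_eq_prod]
  exact h.cont.integrable_of_hasCompactSupport h.hcs

theorem sFT_bound {v : AddCircle (1:ℝ) → ℝ → ℂ} (h : Sm v) (k : ℤ) (η : ℝ) :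
    ‖spacetimeFT v k η‖ ≤ ∫ y : ℝ × AddCircle (1:ℝ), ‖v y.2 y.1‖ := by
  rw [sFT_eq k η h.integrable]
  refine (norm_integral_le_integral_norm _).trans (le_of_eq ?_)
  simp_rw [norm_mul, Ech_norm, mul_one]

theorem sFT_dx {v : AddCircle (1:ℝ) → ℝ → ℂ} (h : Sm v) (k : ℤ) (η : ℝ) :
    spacetimeFT (dxv v) k η = (2 * Real.pi * Complex.I * k) * spacetimeFT v k η := by
  unfold spacetimeFT
  rw [← integral_const_mul]
  refine integral_congr_ae (Filter.Eventually.of_forall fun t => ?_)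
  dsimp only
  rw [← integral_const_mul, ← sub_eq_zero, ← integral_sub]
  rotate_left
  · have := h.dx.cont.comp (Continuous.prodMk_right t)
    have := (fourier (T := (1:ℝ)) (-k)).continuous
    refine Continuous.integrable_of_hasCompactSupport ?_ (HasCompactSupport.of_compactSpace _)
    simp only [Function.comp_def] at *
    fun_prop
  · have := h.cont.comp (Continuous.prodMk_right t)
    have := (fourier (T := (1:ℝ)) (-k)).continuous
    refine Continuous.integrable_of_hasCompactSupport ?_ (HasCompactSupport.of_compactSpace _)
    simp only [Function.comp_def] at *
    fun_prop
  rw [← AddCircle.intervalIntegral_preimage 1 0]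
  have hd : ∀ a : ℝ, HasDerivAt (fun a : ℝ => v (a : AddCircle (1:ℝ)) t * fourier (-k) (a : AddCircle (1:ℝ)) *
      Complex.exp (-(2 * Real.pi * η * t) * Complex.I))
      (dxv v (a : AddCircle (1:ℝ)) t * fourier (-k) (a : AddCircle (1:ℝ)) * Complex.exp (-(2 * Real.pi * η * t) * Complex.I)
        - 2 * Real.pi * Complex.I * k * (v (a : AddCircle (1:ℝ)) t * fourier (-k) (a : AddCircle (1:ℝ)) * Complex.exp (-(2 * Real.pi * η * t) * Complex.I))) a := by
    intro a
    have h1 := h.hasDerivAt_x a t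
    rw [← h.dxv_eq] at h1
    have h2 := ((h1.mul (hasDerivAt_fourier 1 (-k) a)).mul_const (Complex.exp (-(2 * Real.pi * η * t) * Complex.I)))
    refine h2.congr_deriv ?_
    push_cast
    ring
  rw [intervalIntegral.integral_eq_sub_of_hasDerivAt (fun a _ => hd a)]
  · have : ((0 + 1 : ℝ) : AddCircle (1:ℝ)) = ((0:ℝ) : AddCircle (1:ℝ)) := by
      rw [AddCircle.coe_add, AddCircle.coe_period, add_zero]
    rw [this]; ring
  · apply Continuous.intervalIntegrable
    have c1 := (h.dx.cont.comp (Continuous.prodMk_right t)).comp (AddCircle.continuous_mk' 1)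
    have c2 := (h.cont.comp (Continuous.prodMk_right t)).comp (AddCircle.continuous_mk' 1)
    have c3 := (fourier (T := (1:ℝ)) (-k)).continuous.comp (AddCircle.continuous_mk' 1)
    exact ((c1.mul c3).mul continuous_const).sub (continuous_const.mul ((c2.mul c3).mul continuous_const))

theorem sFT_dt {v : AddCircle (1:ℝ) → ℝ → ℂ} (h : Sm v) (k : ℤ) (η : ℝ) :
    spacetimeFT (dtv v) k η = (2 * Real.pi * Complex.I * η) * spacetimeFT v k η := by
  have cf := (fourier (T := (1:ℝ)) (-k)).continuous
  have sw : ∀ {u : AddCircle (1:ℝ) → ℝ → ℂ}, Sm u → spacetimeFT u k η =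
      ∫ x : AddCircle (1:ℝ), ∫ t : ℝ, u x t * fourier (-k) x * Complex.exp (-(2 * Real.pi * η * t) * Complex.I) := by
    intro u hu
    unfold spacetimeFT
    have := hu.cont
    refine integral_integral_swap_of_hasCompactSupport (f := fun t x => u x t * fourier (-k) x * Complex.exp (-(2 * Real.pi * η * t) * Complex.I)) ?_ ?_
    · simp only [Function.uncurry_def]
      exact (this.mul (cf.comp continuous_snd)).mul (by fun_prop)
    · simp only [Function.uncurry_def, mul_assoc]
      exact hu.hcs.mul_right
  rw [sw h.dt, sw h, ← integral_const_mul]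
  refine integral_congr_ae (Filter.Eventually.of_forall fun x => ?_)
  dsimp only
  obtain ⟨a, rfl⟩ := QuotientAddGroup.mk_surjective x
  have c1 := h.dt.cont.comp (Continuous.prodMk_left (a : AddCircle (1:ℝ)))
  have c2 := h.cont.comp (Continuous.prodMk_left (a : AddCircle (1:ℝ)))
  simp only [Function.comp_def] at c1 c2
  have i1 : Integrable (fun t => dtv v (a : AddCircle (1:ℝ)) t * fourier (-k) (a : AddCircle (1:ℝ)) * Complex.exp (-(2 * Real.pi * η * t) * Complex.I)) := by
    refine Continuous.integrable_of_hasCompactSupport (by fun_prop) ?_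
    simp only [mul_assoc]
    exact (h.dt.hcs_t _).mul_right
  have i2 : Integrable (fun t => v (a : AddCircle (1:ℝ)) t * fourier (-k) (a : AddCircle (1:ℝ)) * Complex.exp (-(2 * Real.pi * η * t) * Complex.I)) := by
    refine Continuous.integrable_of_hasCompactSupport (by fun_prop) ?_
    simp only [mul_assoc]
    exact (h.hcs_t _).mul_right
  change ∫ t, dtv v (a : AddCircle (1:ℝ)) t * fourier (-k) (a : AddCircle (1:ℝ)) * Complex.exp (-(2 * Real.pi * η * t) * Complex.I) =
    _ * ∫ t, v (a : AddCircle (1:ℝ)) t * fourier (-k) (a : AddCircle (1:ℝ)) * Complex.exp (-(2 * Real.pi * η * t) * Complex.I)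
  rw [← integral_const_mul, ← sub_eq_zero, ← integral_sub i1 (i2.const_mul _)]
  refine integral_eq_zero_of_hasDerivAt_of_integrable (f := fun t => v (a : AddCircle (1:ℝ)) t * fourier (-k) (a : AddCircle (1:ℝ)) * Complex.exp (-(2 * Real.pi * η * t) * Complex.I)) ?_ (i1.sub (i2.const_mul _)) i2
  intro t
  have h1 := h.hasDerivAt_t a t
  rw [← h.dtv_eq] at h1
  have h3 : HasDerivAt (fun t : ℝ => Complex.exp (-(2 * Real.pi * η * t) * Complex.I))
      (Complex.exp (-(2 * Real.pi * η * t) * Complex.I) * (-(2 * Real.pi * η * 1) * Complex.I)) t := by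
    have h4 : HasDerivAt (fun t : ℝ => (t:ℂ)) 1 t := Complex.ofRealCLM.hasDerivAt
    exact (((h4.const_mul (2 * Real.pi * η : ℂ)).neg).mul_const Complex.I).cexp
  have h2 := (h1.mul_const (fourier (-k) (a : AddCircle (1:ℝ)))).mul h3
  refine h2.congr_deriv ?_
  ring


theorem sFT_decay {v : AddCircle (1:ℝ) → ℝ → ℂ} (h : Sm v) : ∃ M : ℝ, ∀ (k : ℤ) (η : ℝ),
    ‖spacetimeFT v k η‖ ≤ M * ((1 + (k:ℝ) ^ 2)⁻¹ * (1 + η ^ 2)⁻¹) := by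
  refine ⟨(∫ y : ℝ × AddCircle (1:ℝ), ‖v y.2 y.1‖) + (∫ y : ℝ × AddCircle (1:ℝ), ‖dxv (dxv v) y.2 y.1‖)
    + (∫ y : ℝ × AddCircle (1:ℝ), ‖dtv (dtv v) y.2 y.1‖) +
    (∫ y : ℝ × AddCircle (1:ℝ), ‖dxv (dxv (dtv (dtv v))) y.2 y.1‖), fun k η => ?_⟩
  have b0 := sFT_bound h k η
  have b1 := sFT_bound h.dx.dx k η
  have b2 := sFT_bound h.dt.dt k η
  have b3 := sFT_bound h.dt.dt.dx.dx k η
  rw [sFT_dx h.dx, sFT_dx h] at b1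
  rw [sFT_dt h.dt, sFT_dt h] at b2
  rw [sFT_dx h.dt.dt.dx, sFT_dx h.dt.dt, sFT_dt h.dt, sFT_dt h] at b3
  simp only [norm_mul, Complex.norm_ofNat, Complex.norm_real, Complex.norm_I, Complex.norm_intCast, Real.norm_eq_abs,
    mul_one, abs_of_pos Real.pi_pos] at b1 b2 b3
  set F := ‖spacetimeFT v k η‖
  have hF : 0 ≤ F := norm_nonneg _
  have hpi := Real.pi_gt_three
  have h1 : (1:ℝ) ≤ (2 * Real.pi) ^ 2 := by nlinarith
  have ek : |(k:ℝ)| * |(k:ℝ)| = (k:ℝ) ^ 2 := by rw [← sq, sq_abs]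
  have eh : |η| * |η| = η ^ 2 := by rw [← sq, sq_abs]
  have c1 : (k:ℝ) ^ 2 * F ≤ 2 * Real.pi * |(k:ℝ)| * (2 * Real.pi * |(k:ℝ)| * F) := by
    calc (k:ℝ) ^ 2 * F ≤ (2 * Real.pi) ^ 2 * ((k:ℝ) ^ 2 * F) := le_mul_of_one_le_left (by positivity) h1
      _ = _ := by rw [← ek]; ring
  have c2 : η ^ 2 * F ≤ 2 * Real.pi * |η| * (2 * Real.pi * |η| * F) := by
    calc η ^ 2 * F ≤ (2 * Real.pi) ^ 2 * (η ^ 2 * F) := le_mul_of_one_le_left (by positivity) h1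
      _ = _ := by rw [← eh]; ring
  have c3 : (k:ℝ) ^ 2 * (η ^ 2 * F) ≤ 2 * Real.pi * |(k:ℝ)| * (2 * Real.pi * |(k:ℝ)| * (2 * Real.pi * |η| * (2 * Real.pi * |η| * F))) := by
    calc (k:ℝ) ^ 2 * (η ^ 2 * F) ≤ (2 * Real.pi) ^ 2 * ((2 * Real.pi) ^ 2 * ((k:ℝ) ^ 2 * (η ^ 2 * F))) :=
          (le_mul_of_one_le_left (by positivity) h1).trans (le_mul_of_one_le_left (by positivity) h1)
      _ = _ := by rw [← eh, ← ek]; ring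
  rw [← mul_inv, ← div_eq_mul_inv, le_div_iff₀ (by positivity)]
  nlinarith

theorem Ech_meas_left (y : ℝ × AddCircle (1:ℝ)) : Measurable (fun z : ℤ × ℝ => Ech z y) := by
  exact Measurable.of_uncurry_right (f := Ech) Ech_meas

theorem Ech_meas_neg : Measurable (fun q : (ℤ × ℝ) × (ℝ × AddCircle (1:ℝ)) => Ech (-q.1) q.2) := by
  refine Ech_meas.comp (f := fun q : (ℤ × ℝ) × (ℝ × AddCircle (1:ℝ)) => (-q.1, q.2)) ?_
  exact measurable_fst.neg.prodMk measurable_snd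

theorem sFT_meas {v : AddCircle (1:ℝ) → ℝ → ℂ} (h : Sm v) : StronglyMeasurable (fun z : ℤ × ℝ => spacetimeFT v z.1 z.2) := by
  have : (fun z : ℤ × ℝ => spacetimeFT v z.1 z.2) = fun z => ∫ y : ℝ × AddCircle (1:ℝ), v y.2 y.1 * Ech (-z) y := by
    funext z; exact sFT_eq z.1 z.2 h.integrable
  rw [this]
  refine StronglyMeasurable.integral_prod_right' (f := fun q : (ℤ × ℝ) × (ℝ × AddCircle (1:ℝ)) => v q.2.2 q.2.1 * Ech (-q.1) q.2) ?_
  refine Measurable.stronglyMeasurable ?_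
  have h2 : Measurable (fun q : (ℤ × ℝ) × (ℝ × AddCircle (1:ℝ)) => v q.2.2 q.2.1) := by
    refine h.cont.measurable.comp (f := fun q : (ℤ × ℝ) × (ℝ × AddCircle (1:ℝ)) => q.2) ?_
    exact measurable_snd
  exact h2.mul Ech_meas_neg

theorem sFT_integrable {v : AddCircle (1:ℝ) → ℝ → ℂ} (h : Sm v) :
    Integrable (fun z : ℤ × ℝ => spacetimeFT v z.1 z.2) mZ := by
  obtain ⟨M, hM⟩ := sFT_decay h
  have i1 : Integrable (fun k : ℤ => (1 + (k:ℝ) ^ 2)⁻¹) Measure.count := by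
    rw [integrable_count_iff]
    have : Summable (fun k : ℤ => 1 / (k:ℝ) ^ 2) := Real.summable_one_div_int_pow.2 (by norm_num)
    have h2 : Summable (fun k : ℤ => 1 / (k:ℝ) ^ 2 + if k = 0 then 1 else 0) :=
      this.add (summable_of_ne_finset_zero (s := {0}) fun k hk => by simpa using hk)
    refine Summable.of_nonneg_of_le (fun _ => norm_nonneg _) (fun k => ?_) h2
    rw [Real.norm_of_nonneg (by positivity)]
    by_cases hk : k = 0
    · subst hk; simp
    · simp only [hk, if_false, add_zero, one_div]
      have : (0:ℝ) < (k:ℝ) ^ 2 := by positivity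
      gcongr; linarith
  have i2 := (i1.mul_prod integrable_inv_one_add_sq).const_mul M
  refine i2.mono' (sFT_meas h).aestronglyMeasurable (Filter.Eventually.of_forall fun z => hM _ _)

/-- `u` is represented by the Fourier density `U`. -/
def HasRep (u : AddCircle (1:ℝ) → ℝ → ℂ) (U : ℤ × ℝ → ℂ) : Prop :=
  Integrable U mZ ∧ ∀ x t, u x t = ∫ z, U z * Ech z (t, x) ∂mZ

theorem Ech_mul_int {U : ℤ × ℝ → ℂ} (h : Integrable U mZ) (y) : Integrable (fun z => U z * Ech z y) mZ :=
  h.mul_bdd (c := 1) (Ech_meas_left y).aestronglyMeasurable (Filter.Eventually.of_forall fun z => (Ech_norm _ _).le)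

theorem rep_sm {v : AddCircle (1:ℝ) → ℝ → ℂ} (h : Sm v) : HasRep v (fun z => spacetimeFT v z.1 z.2) := by
  refine ⟨sFT_integrable h, fun x t => ?_⟩
  have hi := Ech_mul_int (sFT_integrable h) (t, x)
  have hvol : (volume : Measure (AddCircle (1:ℝ))) = AddCircle.haarAddCircle := by
    rw [AddCircle.volume_eq_smul_haarAddCircle]; simp
  -- Fourier coefficients at fixed time
  set c : ℤ → ℝ → ℂ := fun k t => ∫ x : AddCircle (1:ℝ), v x t * fourier (-k) x with hc
  have hcc : ∀ k, Continuous (c k) := by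
    intro k
    have h1 : Continuous (fun t => ∫ x in Set.univ, v x t * fourier (-k) x) := by
      refine continuous_parametric_integral_of_continuous (f := fun t x => v x t * fourier (-k) x) ?_ isCompact_univ
      exact h.cont.mul ((fourier (T := (1:ℝ)) (-k)).continuous.comp continuous_snd)
    rw [hc]; simpa only [Measure.restrict_univ] using h1
  have hcs : ∀ k, HasCompactSupport (c k) := by
    intro k
    obtain ⟨R, hR⟩ := h.supp
    refine HasCompactSupport.intro (K := Metric.closedBall 0 R) (isCompact_closedBall _ _) ?_
    intro p hp
    have : R ≤ |p| := by
      by_contra hcon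
      apply hp
      simp only [Metric.mem_closedBall, dist_zero_right, Real.norm_eq_abs]
      linarith
    simp [hc, hR _ p this]
  have hF : ∀ k, FourierTransform.fourier (c k) = fun η => spacetimeFT v k η := by
    intro k
    funext η
    rw [Real.fourier_eq']
    unfold spacetimeFT
    refine integral_congr_ae (Filter.Eventually.of_forall fun t => ?_)
    dsimp only
    rw [integral_mul_const, smul_eq_mul, mul_comm]
    congr 2
    simp only [RCLike.inner_apply, conj_trivial]
    push_cast
    ring
  have hslice : ∀ k, Integrable (fun η => spacetimeFT v k η) := by
    obtain ⟨M, hM⟩ := sFT_decay h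
    intro k
    refine ((integrable_inv_one_add_sq.const_mul ((1 + (k:ℝ) ^ 2)⁻¹)).const_mul M).mono' ?_ (Filter.Eventually.of_forall fun η => hM k η)
    have h1 : Measurable (fun η : ℝ => (k, η)) := by fun_prop
    exact ((sFT_meas h).measurable.comp h1).aestronglyMeasurable
  have hinv : ∀ k, c k t = ∫ η, spacetimeFT v k η * Complex.exp ((2 * Real.pi * η * t : ℝ) * Complex.I) := by
    intro k
    have h1 := (hcc k).fourierInv_fourier_eq ((hcc k).integrable_of_hasCompactSupport (hcs k)) (by rw [hF]; exact hslice k)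
    rw [hF] at h1
    rw [← congrFun h1 t, Real.fourierInv_eq']
    refine integral_congr_ae (Filter.Eventually.of_forall fun η => ?_)
    dsimp only
    rw [smul_eq_mul, mul_comm]
    congr 3
    simp only [RCLike.inner_apply, conj_trivial]
    push_cast
    ring
  have hcoef : ∀ k, fourierCoeff (fun x => v x t) k = c k t := by
    intro k
    unfold fourierCoeff
    rw [hc, hvol]
    simp only [smul_eq_mul, mul_comm]
  have hct : Continuous (fun x => v x t) := h.cont.comp (Continuous.prodMk_right t)
  have hsumm : Summable (fun k => ‖∫ η, spacetimeFT v k η * Complex.exp ((2 * Real.pi * η * t : ℝ) * Complex.I)‖) := by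
    have h0 := (Ech_mul_int (sFT_integrable h) (t, 0)).integral_prod_left
    rw [integrable_count_iff] at h0
    simpa [Ech] using h0
  have hS : Summable (fourierCoeff (⇑(⟨fun x => v x t, hct⟩ : C(AddCircle (1:ℝ), ℂ)))) := by
    refine Summable.of_norm ?_
    refine hsumm.congr fun k => ?_
    rw [← hinv k, ← hcoef k]
    rfl
  have hsum := has_pointwise_sum_fourier_series_of_summable hS x
  rw [integral_prod _ hi, integral_countable hi.integral_prod_left]
  simp only [ContinuousMap.coe_mk] at hsum
  rw [← hsum.tsum_eq]
  refine tsum_congr fun k => ?_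
  rw [hcoef, hinv]
  simp only [Measure.real, Measure.count_singleton, ENNReal.toReal_one, one_smul, smul_eq_mul, Ech]
  rw [← integral_mul_const]
  refine integral_congr_ae (Filter.Eventually.of_forall fun η => ?_)
  dsimp only
  ring


instance mZ_rinv : mZ.IsAddRightInvariant := by
  constructor
  intro g
  have := map_add_left_eq_self mZ g
  simpa only [add_comm] using this

/-- Fourier density with a measurable majorant. -/
structure RepB (u : AddCircle (1:ℝ) → ℝ → ℂ) (A : ℤ × ℝ → ℝ≥0∞) (U : ℤ × ℝ → ℂ) : Prop where
  rep : HasRep u U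
  meas : Measurable A
  le : ∀ z, ‖U z‖ₑ ≤ A z

theorem repB_sm {v : AddCircle (1:ℝ) → ℝ → ℂ} (h : Sm v) :
    RepB v (fun z => ‖spacetimeFT v z.1 z.2‖ₑ) (fun z => spacetimeFT v z.1 z.2) :=
  ⟨rep_sm h, (sFT_meas h).measurable.enorm, fun _ => le_rfl⟩

theorem repB_conj {u : AddCircle (1:ℝ) → ℝ → ℂ} {A : ℤ × ℝ → ℝ≥0∞} {U : ℤ × ℝ → ℂ} (h : RepB u A U) :
    RepB (fun x t => (starRingEnd ℂ) (u x t)) (fun z => A (-z)) (fun z => (starRingEnd ℂ) (U (-z))) := by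
  refine ⟨⟨?_, fun x t => ?_⟩, h.meas.comp measurable_neg, fun z => ?_⟩
  · have h1 : Integrable (fun z => U (-z)) mZ := h.rep.1.comp_neg
    exact (Complex.conjCLE : ℂ →L[ℝ] ℂ).integrable_comp h1
  · dsimp only
    rw [h.rep.2 x t, ← integral_conj, ← integral_neg_eq_self]
    refine integral_congr_ae (Filter.Eventually.of_forall fun z => ?_)
    dsimp only
    rw [map_mul, Ech_neg, Complex.conj_conj]
  · have := h.le (-z)
    rwa [← ofReal_norm, Complex.norm_conj, ofReal_norm]

theorem repB_mul {u u' : AddCircle (1:ℝ) → ℝ → ℂ} {A A' : ℤ × ℝ → ℝ≥0∞} {U U' : ℤ × ℝ → ℂ}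
    (h : RepB u A U) (h' : RepB u' A' U') :
    RepB (fun x t => u x t * u' x t) (A ⋆ₗ[mZ] A') (fun z => ∫ y, U y * U' (z - y) ∂mZ) := by
  refine ⟨⟨?_, fun x t => ?_⟩, ?_, fun z => ?_⟩
  · exact h.rep.1.integrable_convolution (ContinuousLinearMap.mul ℂ ℂ) h'.rep.1
  · have h1 := integral_convolution (ContinuousLinearMap.mul ℂ ℂ) (Ech_mul_int h.rep.1 (t, x)) (Ech_mul_int h'.rep.1 (t, x))
    dsimp only
    rw [h.rep.2, h'.rep.2]
    refine Eq.trans h1.symm ?_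
    refine integral_congr_ae (Filter.Eventually.of_forall fun z => ?_)
    dsimp only
    rw [convolution_def, ← integral_mul_const]
    refine integral_congr_ae (Filter.Eventually.of_forall fun y => ?_)
    simp only [ContinuousLinearMap.mul_apply']
    have : Ech z (t, x) = Ech y (t, x) * Ech (z - y) (t, x) := by rw [← Ech_add]; congr 1; abel
    rw [this]; ring
  · have h1 := h.meas
    have h2 := h'.meas
    fun_prop
  · refine (enorm_integral_le_lintegral_enorm _).trans ?_
    rw [lconvolution_def]
    refine lintegral_mono fun y => ?_
    dsimp only
    rw [enorm_mul]
    refine mul_le_mul' (h.le _) ?_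
    rw [show -y + z = z - y by abel]
    exact h'.le _

theorem repB_w {u : AddCircle (1:ℝ) → ℝ → ℂ} {A : ℤ × ℝ → ℝ≥0∞} {U : ℤ × ℝ → ℂ}
    (h : RepB u A U) {w : AddCircle (1:ℝ) → ℝ} (hw : Integrable w) :
    RepB (fun x t => ∫ y, (w (x - y) : ℂ) * u y t) (fun z => eLpNorm w 1 volume * A z)
      (fun z => (∫ y, (w y : ℂ) * fourier (-z.1) y) * U z) := by
  have hWm : ∀ z : ℤ × ℝ, ‖∫ y, (w y : ℂ) * fourier (-z.1) y‖ₑ ≤ eLpNorm w 1 volume := by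
    intro z
    refine (enorm_integral_le_lintegral_enorm _).trans ?_
    rw [eLpNorm_one_eq_lintegral_enorm]
    refine lintegral_mono fun y => ?_
    dsimp only
    rw [enorm_mul]
    have e1 : ‖(fourier (-z.1) y : ℂ)‖ₑ = 1 := by
      rw [← ofReal_norm, show ‖(fourier (-z.1) y : ℂ)‖ = 1 from Circle.norm_coe _]; simp
    have e2 : ‖(w y : ℂ)‖ₑ = ‖w y‖ₑ := by
      rw [← ofReal_norm, Complex.norm_real, ofReal_norm]
    rw [e1, e2, mul_one]
  refine ⟨⟨?_, fun x t => ?_⟩, h.meas.const_mul _, fun z => ?_⟩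
  · refine h.rep.1.bdd_mul (c := (eLpNorm w 1 volume).toReal) ?_ (Filter.Eventually.of_forall fun z => ?_)
    · have hm : Measurable (fun z : ℤ × ℝ => ∫ y, (w y : ℂ) * fourier (-z.1) y) :=
        (measurable_of_countable (fun k : ℤ => ∫ y, (w y : ℂ) * fourier (-k) y)).comp measurable_fst
      exact hm.aestronglyMeasurable
    · have := ENNReal.toReal_mono (memLp_one_iff_integrable.2 hw).eLpNorm_ne_top (hWm z)
      simpa using this
  · have hwc : Integrable (fun y => (w y : ℂ)) := hw.ofReal
    have hj : Integrable (fun q : AddCircle (1:ℝ) × (ℤ × ℝ) => ((w q.1 : ℂ) * U q.2) * Ech q.2 (t, x - q.1))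
        (volume.prod mZ) := by
      refine (hwc.mul_prod h.rep.1).mul_bdd (c := 1) ?_ (Filter.Eventually.of_forall fun z => (Ech_norm _ _).le)
      refine Measurable.aestronglyMeasurable ?_
      refine Ech_meas.comp (f := fun q : AddCircle (1:ℝ) × (ℤ × ℝ) => (q.2, ((t, x - q.1) : ℝ × AddCircle (1:ℝ)))) ?_
      exact measurable_snd.prodMk (measurable_const.prodMk (measurable_fst.const_sub x))
    dsimp only
    rw [← integral_sub_left_eq_self _ volume x]
    simp only [sub_sub_cancel]
    calc ∫ y, (w y : ℂ) * u (x - y) t = ∫ y, ∫ z, ((w y : ℂ) * U z) * Ech z (t, x - y) ∂mZ := by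
          refine integral_congr_ae (Filter.Eventually.of_forall fun y => ?_)
          dsimp only
          rw [h.rep.2, ← integral_const_mul]
          simp only [mul_assoc]
      _ = ∫ z, (∫ y, ((w y : ℂ) * U z) * Ech z (t, x - y)) ∂mZ := integral_integral_swap hj
      _ = _ := by
          refine integral_congr_ae (Filter.Eventually.of_forall fun z => ?_)
          dsimp only
          rw [mul_assoc, ← integral_mul_const]
          refine integral_congr_ae (Filter.Eventually.of_forall fun y => ?_)
          dsimp only
          have : Ech z (t, x - y) = fourier (-z.1) y * Ech z (t, x) := by
            unfold Ech
            dsimp only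
            rw [show (fourier z.1 (x - y) : ℂ) = fourier (-z.1) y * fourier z.1 x by
              simp only [fourier_apply]
              rw [← Circle.coe_mul, ← AddCircle.toCircle_add]
              congr 2
              rw [smul_sub, neg_smul]; abel]
            ring
          rw [this]; ring
  · rw [enorm_mul]
    exact mul_le_mul' (hWm z) (h.le z)

theorem sFT_mul_le {u v : AddCircle (1:ℝ) → ℝ → ℂ} {A : ℤ × ℝ → ℝ≥0∞} {U : ℤ × ℝ → ℂ}
    (h : RepB u A U) (hv : Sm v) (k : ℤ) (η : ℝ) :
    ‖spacetimeFT (fun x t => u x t * v x t) k η‖ₑ ≤ (A ⋆ₗ[mZ] (fun z => ‖spacetimeFT v z.1 z.2‖ₑ)) (k, η) := by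
  have hj : Integrable (fun q : (ℝ × AddCircle (1:ℝ)) × (ℤ × ℝ) => (v q.1.2 q.1.1 * U q.2) * Ech q.2 q.1)
      ((volume : Measure (ℝ × AddCircle (1:ℝ))).prod mZ) := by
    refine (hv.integrable.mul_prod h.rep.1).mul_bdd (c := 1) ?_ (Filter.Eventually.of_forall fun z => (Ech_norm _ _).le)
    refine Measurable.aestronglyMeasurable ?_
    refine Ech_meas.comp (f := fun q : (ℝ × AddCircle (1:ℝ)) × (ℤ × ℝ) => (q.2, q.1)) ?_
    exact measurable_snd.prodMk measurable_fst
  have hj2 : Integrable (fun q : (ℝ × AddCircle (1:ℝ)) × (ℤ × ℝ) =>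
      ((v q.1.2 q.1.1 * U q.2) * Ech q.2 q.1) * Ech (-(k, η)) q.1)
      ((volume : Measure (ℝ × AddCircle (1:ℝ))).prod mZ) := by
    refine hj.mul_bdd (c := 1) ?_ (Filter.Eventually.of_forall fun z => (Ech_norm _ _).le)
    refine Measurable.aestronglyMeasurable ?_
    refine Ech_meas.comp (f := fun q : (ℝ × AddCircle (1:ℝ)) × (ℤ × ℝ) => (-(k, η), q.1)) ?_
    exact measurable_const.prodMk measurable_fst
  have hu : ∀ y : ℝ × AddCircle (1:ℝ), ∫ z, (v y.2 y.1 * U z) * Ech z y ∂mZ = u y.2 y.1 * v y.2 y.1 := by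
    intro y
    rw [h.rep.2, mul_comm, ← integral_const_mul]
    simp only [mul_assoc]
  have hi : Integrable (fun y : ℝ × AddCircle (1:ℝ) => u y.2 y.1 * v y.2 y.1) := by
    have := hj.integral_prod_left
    simpa only [hu] using this
  rw [sFT_eq k η hi]
  have e : ∫ y : ℝ × AddCircle (1:ℝ), u y.2 y.1 * v y.2 y.1 * Ech (-(k, η)) y =
      ∫ z, U z * spacetimeFT v ((k, η) - z).1 ((k, η) - z).2 ∂mZ := by
    calc _ = ∫ y : ℝ × AddCircle (1:ℝ), ∫ z, ((v y.2 y.1 * U z) * Ech z y) * Ech (-(k, η)) y ∂mZ := by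
          refine integral_congr_ae (Filter.Eventually.of_forall fun y => ?_)
          dsimp only
          rw [integral_mul_const, hu]
      _ = ∫ z, (∫ y : ℝ × AddCircle (1:ℝ), ((v y.2 y.1 * U z) * Ech z y) * Ech (-(k, η)) y) ∂mZ := integral_integral_swap hj2
      _ = _ := by
          refine integral_congr_ae (Filter.Eventually.of_forall fun z => ?_)
          dsimp only
          rw [sFT_eq _ _ hv.integrable, ← integral_const_mul]
          refine integral_congr_ae (Filter.Eventually.of_forall fun y => ?_)
          dsimp only
          have : Ech (-((k, η) - z)) y = Ech z y * Ech (-(k, η)) y := by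
            rw [← Ech_add]; congr 1; abel
          rw [show (((k, η) - z).1, ((k, η) - z).2) = (k, η) - z from rfl, this]; ring
  rw [e]
  refine (enorm_integral_le_lintegral_enorm _).trans ?_
  rw [lconvolution_def]
  refine lintegral_mono fun y => ?_
  dsimp only
  rw [enorm_mul]
  refine mul_le_mul' (h.le _) ?_
  rw [show -y + (k, η) = (k, η) - y by abel]


theorem lconv_cl (c : ℝ≥0∞) {f g : ℤ × ℝ → ℝ≥0∞} (hf : Measurable f) (hg : Measurable g) :
    ((fun z => c * f z) ⋆ₗ[mZ] g) = fun z => c * (f ⋆ₗ[mZ] g) z := by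
  funext z
  simp only [lconvolution_def]
  rw [← lintegral_const_mul _ (by fun_prop)]
  simp only [mul_assoc]

theorem lconv_cr (c : ℝ≥0∞) {f g : ℤ × ℝ → ℝ≥0∞} (hf : Measurable f) (hg : Measurable g) :
    (f ⋆ₗ[mZ] (fun z => c * g z)) = fun z => c * (f ⋆ₗ[mZ] g) z := by
  rw [lconvolution_comm, lconv_cl c hg hf, lconvolution_comm]

theorem N1_eq (w₁ w₂ : AddCircle (1:ℝ) → ℝ) (v : Fin 5 → AddCircle (1:ℝ) → ℝ → ℂ) :
    N1 w₁ w₂ v = fun x t => ((∫ y, (w₁ (x - y) : ℂ) * (v 0 y t * (starRingEnd ℂ) (v 1 y t))) *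
      (∫ y, (w₂ (x - y) : ℂ) * (v 2 y t * (starRingEnd ℂ) (v 3 y t)))) * v 4 x t := by
  funext x t
  unfold N1
  rw [← integral_mul_const, ← integral_mul_const]
  refine integral_congr_ae (Filter.Eventually.of_forall fun y => ?_)
  dsimp only
  rw [← integral_const_mul, ← integral_mul_const]
  refine integral_congr_ae (Filter.Eventually.of_forall fun z => ?_)
  dsimp only
  ring

theorem N1_bound {w₁ w₂ : AddCircle (1:ℝ) → ℝ} (h1 : Integrable w₁) (h2 : Integrable w₂)
    {v : Fin 5 → AddCircle (1:ℝ) → ℝ → ℂ} (hv : ∀ j, Sm (v j)) (a : Fin 5 → ℤ × ℝ → ℝ≥0∞)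
    (ha : ∀ j, a j = fun z => ‖spacetimeFT (v j) z.1 z.2‖ₑ) (k : ℤ) (η : ℝ) :
    ‖spacetimeFT (N1 w₁ w₂ v) k η‖ₑ ≤ eLpNorm w₁ 1 volume * eLpNorm w₂ 1 volume *
      (a 0 ⋆ₗ[mZ] ((fun z => a 1 (-z)) ⋆ₗ[mZ] (a 2 ⋆ₗ[mZ] ((fun z => a 3 (-z)) ⋆ₗ[mZ] a 4)))) (k, η) := by
  have hm : ∀ j, Measurable (a j) := fun j => by rw [ha]; exact (sFT_meas (hv j)).measurable.enorm
  have hm' : ∀ j, Measurable (fun z => a j (-z)) := fun j => (hm j).comp measurable_neg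
  have r : ∀ j, RepB (v j) (a j) (fun z => spacetimeFT (v j) z.1 z.2) := fun j => by
    rw [ha]; exact repB_sm (hv j)
  have p1 := repB_w (repB_mul (r 0) (repB_conj (r 1))) h1
  have p2 := repB_w (repB_mul (r 2) (repB_conj (r 3))) h2
  have p3 := sFT_mul_le (repB_mul p1 p2) (hv 4) k η
  rw [← N1_eq, ← ha 4] at p3
  refine p3.trans (le_of_eq ?_)
  have m0 := hm 0
  have m1 := hm' 1
  have m2 := hm 2
  have m3 := hm' 3
  have m4 := hm 4
  have m01 : Measurable (a 0 ⋆ₗ[mZ] (fun z => a 1 (-z))) := by fun_prop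
  have m23 : Measurable (a 2 ⋆ₗ[mZ] (fun z => a 3 (-z))) := by fun_prop
  have m34 : Measurable ((fun z => a 3 (-z)) ⋆ₗ[mZ] a 4) := by fun_prop
  have m03 : Measurable ((a 0 ⋆ₗ[mZ] (fun z => a 1 (-z))) ⋆ₗ[mZ] (a 2 ⋆ₗ[mZ] (fun z => a 3 (-z)))) := by fun_prop
  have m234 : Measurable (a 2 ⋆ₗ[mZ] ((fun z => a 3 (-z)) ⋆ₗ[mZ] a 4)) := by fun_prop
  rw [lconv_cl _ m01 (m23.const_mul _), lconv_cr _ m01 m23, lconv_cl _ (m03.const_mul _) m4, lconv_cl _ m03 m4,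
    lconvolution_assoc m2 m3 m4, lconvolution_assoc m0 m1 (by fun_prop), lconvolution_assoc m01 m23 m4, mul_assoc]

theorem rho_inv (b y : ℝ) : rho b y * rho (-b) y = 1 := by
  unfold rho
  rw [← ENNReal.ofReal_mul (by positivity), ← Real.rpow_add (by positivity)]
  simp

theorem Xnorm_sq (s b : ℝ) (v : AddCircle (1:ℝ) → ℝ → ℂ) :
    Xnorm s b v ^ 2 = ∑' k : ℤ, ∫⁻ η : ℝ, (JJ s k * (rho (-b) (η + 2 * Real.pi * (k:ℝ)^2) * ‖spacetimeFT v k η‖ₑ)) ^ 2 := by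
  unfold Xnorm
  rw [← ENNReal.rpow_natCast, ← ENNReal.rpow_mul]
  norm_num
  refine tsum_congr fun k => lintegral_congr fun η => ?_
  rw [mul_pow, mul_pow, JJ, rho_sq, rho_sq, ENNReal.ofReal_mul (by positivity), ENNReal.ofReal_mul (by positivity),
    ENNReal.ofReal_pow (by positivity), ofReal_norm, rho, rho, mul_assoc]
  simp

theorem final_est :
    ∀ s : ℝ, 0 < s → ∃ ε₀ : ℝ, 0 < ε₀ ∧ ε₀ < 1/2 ∧
    ∀ ε : ℝ, 0 < ε → ε < ε₀ → ∃ C : ℝ, 0 < C ∧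
    ∀ w₁ w₂ : AddCircle (1:ℝ) → ℝ, Integrable w₁ → Integrable w₂ →
    ∀ v : Fin 5 → AddCircle (1:ℝ) → ℝ → ℂ, (∀ j, Sm (v j)) →
      Xnorm s (-(1/2) + ε) (N1 w₁ w₂ v) ≤
        ENNReal.ofReal C * eLpNorm w₁ 1 volume * eLpNorm w₂ 1 volume *
          ∏ j : Fin 5, Xnorm s (1/2 - ε) (v j) := by
  intro s hs
  obtain ⟨ε₀, h0, h1, H⟩ := quint_conv s hs
  refine ⟨ε₀, h0, h1, fun ε hε hε0 => ?_⟩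
  obtain ⟨D, hD, T⟩ := H ε hε hε0
  refine ⟨√D.toReal + 1, by positivity, ?_⟩
  intro w₁ w₂ hw1 hw2 v hv
  have hDC : D ≤ ENNReal.ofReal (√D.toReal + 1) ^ 2 := by
    rw [← ENNReal.ofReal_pow (by positivity)]
    refine ENNReal.le_ofReal_iff_toReal_le hD (by positivity) |>.2 ?_
    have := Real.sq_sqrt (ENNReal.toReal_nonneg (a := D))
    nlinarith [Real.sqrt_nonneg D.toReal]
  set a : Fin 5 → ℤ × ℝ → ℝ≥0∞ := fun j z => ‖spacetimeFT (v j) z.1 z.2‖ₑ with ha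
  have hm : ∀ j, Measurable (a j) := fun j => (sFT_meas (hv j)).measurable.enorm
  set F : Fin 5 → ℤ × ℝ → ℝ≥0∞ := fun j z =>
    JJ s z.1 * (rho (-(1/2 - ε)) (z.2 + 2 * Real.pi * (z.1:ℝ)^2) * a j z) with hF
  have hFm : ∀ j, Measurable (F j) := fun j => by
    refine (JJ_meas s).mul (Measurable.mul ?_ (hm j))
    have := rho_measurable (-(1/2 - ε))
    exact meas_mZ fun k => by fun_prop
  have hFm' : ∀ j, Measurable (fun z => F j (-z)) := fun j => (hFm j).comp measurable_neg
  have hPA : ∀ j, a j = PA s ε (F j) := by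
    intro j
    funext z
    have e1 := JJ_jj s z.1
    have e2 := rho_inv (1/2 - ε) (z.2 + 2 * Real.pi * (z.1:ℝ)^2)
    simp only [PA, hF, pz]
    calc a j z = (JJ s z.1 * jj s z.1) * ((rho (1/2 - ε) (z.2 + 2 * Real.pi * (z.1:ℝ)^2) *
          rho (-(1/2 - ε)) (z.2 + 2 * Real.pi * (z.1:ℝ)^2)) * a j z) := by rw [e1, e2, one_mul, one_mul]
      _ = _ := by ring
  have hQA : ∀ j, (fun z => a j (-z)) = QA s ε (fun z => F j (-z)) := by
    intro j; rw [hPA, PA_neg]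
  have hI : ∀ j, I2 (F j) = Xnorm s (1/2 - ε) (v j) ^ 2 := by
    intro j
    rw [Xnorm_sq, I2, lint_mZ ((hFm j).pow_const 2)]
  have hT := T (F 0) (fun z => F 1 (-z)) (F 2) (fun z => F 3 (-z)) (F 4) (hFm 0) (hFm' 1) (hFm 2) (hFm' 3) (hFm 4)
  rw [I2_neg, I2_neg, ← hPA, ← hPA, ← hPA, ← hQA, ← hQA] at hT
  simp only [hI] at hT
  have hb := N1_bound hw1 hw2 hv a (fun j => rfl)
  set G := a 0 ⋆ₗ[mZ] ((fun z => a 1 (-z)) ⋆ₗ[mZ] (a 2 ⋆ₗ[mZ] ((fun z => a 3 (-z)) ⋆ₗ[mZ] a 4))) with hG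
  have hGm : Measurable G := by
    have m0 := hm 0
    have m1 : Measurable (fun z => a 1 (-z)) := (hm 1).comp measurable_neg
    have m2 := hm 2
    have m3 : Measurable (fun z => a 3 (-z)) := (hm 3).comp measurable_neg
    have m4 := hm 4
    rw [hG]
    fun_prop
  have hX : Xnorm s (-(1/2) + ε) (N1 w₁ w₂ v) ^ 2 ≤
      (eLpNorm w₁ 1 volume * eLpNorm w₂ 1 volume) ^ 2 * I2 (fun z => pz ε z * (JJ s z.1 * G z)) := by
    have hm2 : Measurable (fun z => (pz ε z * (JJ s z.1 * G z)) ^ 2) :=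
      ((pz_meas ε).mul ((JJ_meas s).mul hGm)).pow_const 2
    rw [Xnorm_sq, I2, ← lintegral_const_mul _ hm2, lint_mZ (hm2.const_mul _)]
    refine ENNReal.tsum_le_tsum fun k => lintegral_mono fun η => ?_
    dsimp only
    rw [← mul_pow]
    refine pow_le_pow_left' ?_ 2
    rw [show -(-(1/2) + ε) = 1/2 - ε by ring]
    calc _ ≤ JJ s k * (rho (1/2 - ε) (η + 2 * Real.pi * (k:ℝ)^2) * (eLpNorm w₁ 1 volume * eLpNorm w₂ 1 volume * G (k, η))) := by
          gcongr
          exact hb k η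
      _ = _ := by simp only [pz]; ring
  rw [← ENNReal.pow_le_pow_left_iff (n := 2) (by norm_num)]
  refine hX.trans ?_
  calc _ ≤ (eLpNorm w₁ 1 volume * eLpNorm w₂ 1 volume) ^ 2 * (ENNReal.ofReal (√D.toReal + 1) ^ 2 * _) := by
        gcongr
        exact hT.trans (mul_le_mul_left hDC _)
    _ = _ := by rw [Fin.prod_univ_five]; ring

/-- **Global-in-time quintic multilinear estimate for `𝒩₁`** (proof of Lemma 2.5):
for every `s > 0` there is `ε₀ ∈ (0,1/2)` such that for all `ε ∈ (0,ε₀)` there is `C > 0` with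
`‖𝒩₁(v₁,…,v₅)‖_{X^{s,−1/2+ε}} ≤ C ‖w₁‖_{L¹} ‖w₂‖_{L¹} ∏_j ‖v_j‖_{X^{s,1/2−ε}}`
for all `w₁, w₂ ∈ L¹(Λ;ℝ)` and all smooth `v_j : Λ × ℝ → ℂ` compactly supported in time. -/
theorem quintic_multilinear_estimate_N1 :
    ∀ s : ℝ, 0 < s → ∃ ε₀ : ℝ, 0 < ε₀ ∧ ε₀ < 1/2 ∧
    ∀ ε : ℝ, 0 < ε → ε < ε₀ → ∃ C : ℝ, 0 < C ∧
    ∀ w₁ w₂ : AddCircle (1:ℝ) → ℝ, Integrable w₁ → Integrable w₂ →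
    ∀ v : Fin 5 → AddCircle (1:ℝ) → ℝ → ℂ,
      (∀ j, ContDiff ℝ (⊤ : ℕ∞) (fun p : ℝ × ℝ => v j ((p.1 : ℝ) : AddCircle (1:ℝ)) p.2)) →
      (∀ j, ∃ R : ℝ, ∀ (x : AddCircle (1:ℝ)) (t : ℝ), R ≤ |t| → v j x t = 0) →
      Xnorm s (-(1/2) + ε) (N1 w₁ w₂ v) ≤
        ENNReal.ofReal C * eLpNorm w₁ 1 volume * eLpNorm w₂ 1 volume *
          ∏ j : Fin 5, Xnorm s (1/2 - ε) (v j) := by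
  intro s hs
  obtain ⟨ε₀, h0, h1, H⟩ := final_est s hs
  refine ⟨ε₀, h0, h1, fun ε hε hε0 => ?_⟩
  obtain ⟨C, hC, T⟩ := H ε hε hε0
  exact ⟨C, hC, fun w₁ w₂ hw1 hw2 v hv hR => T w₁ w₂ hw1 hw2 v (fun j => ⟨hv j, hR j⟩)⟩

end
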